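/- Under the combined hypotheses of the bias and variance propositions (g, f ∈ C²([0,1]) with g'', f'' Lipschitz, f a density with inf f > 0; K an even kernel supported in [−1,1], C² with K'' Lipschitz and ∫K = 1; R continuous with continuous jump function α and bounded off-diagonal mixed partials up to order 2, R^{(0,2)}(t,·) Lipschitz; x ∈ (0,1)), the mean squared error MSE_{n,m,h}(x) = Bias_{n,h}(x)² + Q_{n,h}(x)/m of the trapezoidal estimator based on m independent units satisfies: there exist C > 0 and ρ(h) → 0 (h → 0⁺) with |MSE_{n,m,h}(x) − (1/m)(R(x,x) − (h/2)α(x)C_K) − (V/(12mn²h)) α(x)/f(x)² − (1/4)h⁴ g''(x)² B²| ≤ ρ(h)(h⁴ + h/m) + C(1/(n³h) + 1/(mn³h³) + 1/(mn²) + 1/(n⁶h⁶)) for all n, m ≥ 1 and h with nh ≥ 1 and [x−h,x+h] ⊆ [0,1]. -/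

import Mathlib

open MeasureTheory Filter
open scoped Classical Topology

/-- The scaled kernel φ_{x,h}(s) = (1/h) K((x−s)/h). -/
noncomputable def phiK (K : ℝ → ℝ) (x h s : ℝ) : ℝ := (1 / h) * K ((x - s) / h)

/-- Indices of consecutive pairs of design points both lying in [x−h, x+h]. -/
noncomputable def trapIdx (t : ℕ → ℕ → ℝ) (n : ℕ) (x h : ℝ) : Finset ℕ :=
  (Finset.Icc 1 (n - 1)).filter
    (fun i => t n i ∈ Set.Icc (x - h) (x + h) ∧ t n (i + 1) ∈ Set.Icc (x - h) (x + h))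


/-- The trapezoidal sum (1/(2n)) Σ_{k=1}^{N−1} (G(t_{x,k}) + G(t_{x,k+1})). -/
noncomputable def trapSum (t : ℕ → ℕ → ℝ) (n : ℕ) (x h : ℝ) (G : ℝ → ℝ) : ℝ :=
  (1 / (2 * (n : ℝ))) * ∑ i ∈ trapIdx t n x h, (G (t n i) + G (t n (i + 1)))

/-- Φ(u,v) = (φ_{x,h}(u)/f(u)) R(u,v) (φ_{x,h}(v)/f(v)). -/
noncomputable def PhiR (K f : ℝ → ℝ) (R : ℝ → ℝ → ℝ) (x h u v : ℝ) : ℝ :=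
  (phiK K x h u / f u) * R u v * (phiK K x h v / f v)

/-- The variance quadratic form Q_{n,h}(x) of the trapezoidal estimator:
    (1/(4n²)) Σ_{i=1}^{N−1} Σ_{j=1}^{N−1} [Φ(t_{x,i},t_{x,j}) + Φ(t_{x,i},t_{x,j+1})
      + Φ(t_{x,i+1},t_{x,j}) + Φ(t_{x,i+1},t_{x,j+1})]. -/
noncomputable def Qform (K f : ℝ → ℝ) (R : ℝ → ℝ → ℝ) (t : ℕ → ℕ → ℝ)
    (n : ℕ) (x h : ℝ) : ℝ :=
  (1 / (4 * (n : ℝ) ^ 2)) * ∑ i ∈ trapIdx t n x h, ∑ j ∈ trapIdx t n x h,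
    (PhiR K f R x h (t n i) (t n j) + PhiR K f R x h (t n i) (t n (j + 1))
      + PhiR K f R x h (t n (i + 1)) (t n j)
      + PhiR K f R x h (t n (i + 1)) (t n (j + 1)))

/-- Mean value inequality on a compact interval, with the derivative known in the interior. -/
lemma abs_sub_le_of_abs_hasDerivAt_le {e e' : ℝ → ℝ} {a b B : ℝ} (hab : a ≤ b)
    (hc : ContinuousOn e (Set.Icc a b)) (hd : ∀ s ∈ Set.Ioo a b, HasDerivAt e (e' s) s)
    (hB : ∀ s ∈ Set.Ioo a b, |e' s| ≤ B) : |e b - e a| ≤ B * (b - a) := by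
  rcases hab.eq_or_lt with rfl | hlt
  · simp
  · obtain ⟨c, hcm, hce⟩ := exists_hasDerivAt_eq_slope e e' hlt hc hd
    have h1 : e b - e a = e' c * (b - a) := by
      rw [hce]; field_simp [sub_ne_zero.2 hlt.ne']
    rw [h1, abs_mul, abs_of_pos (sub_pos.2 hlt)]
    exact mul_le_mul_of_nonneg_right (hB c hcm) (sub_pos.2 hlt).le

/-- Mean value inequality on an order-connected set. -/
lemma abs_sub_le_of_abs_hasDerivWithinAt_le {S : Set ℝ} (hS : S.OrdConnected)
    {e e' : ℝ → ℝ} {B : ℝ}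
    (hd : ∀ s ∈ S, HasDerivWithinAt e (e' s) S s) (hB : ∀ s ∈ S, |e' s| ≤ B)
    {s u : ℝ} (hs : s ∈ S) (hu : u ∈ S) : |e s - e u| ≤ B * |s - u| := by
  have := Convex.norm_image_sub_le_of_norm_hasDerivWithin_le (f := e) (f' := e') (C := B)
    (s := S) (x := u) (y := s) hd (by simpa using hB) hS.convex hu hs
  simpa using this

/-- `G` has first and second derivatives `G1`, `G2` on `S`, of sizes `M / h` and `M / h ^ 2`, and
`G2` is Lipschitz on `S` with constant `M / h ^ 3`. -/
structure ScaledC2 (S : Set ℝ) (M h : ℝ) (G G1 G2 : ℝ → ℝ) : Prop where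
  deriv : ∀ s ∈ S, HasDerivWithinAt G (G1 s) S s
  deriv1 : ∀ s ∈ S, HasDerivWithinAt G1 (G2 s) S s
  bound : ∀ s ∈ S, |G s| ≤ M
  bound1 : ∀ s ∈ S, |G1 s| ≤ M / h
  bound2 : ∀ s ∈ S, |G2 s| ≤ M / h ^ 2
  lip2 : ∀ s ∈ S, ∀ u ∈ S, |G2 s - G2 u| ≤ M / h ^ 3 * |s - u|

lemma abs_mul_sub_mul_le {a a' b b' A A' B B' d : ℝ} (ha : |a| ≤ A) (hb' : |b'| ≤ B)
    (hA : |a - a'| ≤ A' * d) (hB : |b - b'| ≤ B' * d) :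
    |a * b - a' * b'| ≤ (A * B' + A' * B) * d := by
  have h1 : a * b - a' * b' = a * (b - b') + (a - a') * b' := by ring
  rw [h1]
  refine (abs_add_le _ _).trans ?_
  rw [abs_mul, abs_mul, add_mul]
  have h2 : |a| * |b - b'| ≤ A * (B' * d) :=
    mul_le_mul ha hB (abs_nonneg _) ((abs_nonneg _).trans ha)
  have h3 : |a - a'| * |b'| ≤ (A' * d) * B :=
    mul_le_mul hA hb' (abs_nonneg _) ((abs_nonneg _).trans hA)
  linarith

namespace ScaledC2

variable {S : Set ℝ} {M M' h : ℝ} {G G1 G2 H H1 H2 : ℝ → ℝ}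

lemma lip0 (hG : ScaledC2 S M h G G1 G2) (hS : S.OrdConnected) {s u : ℝ} (hs : s ∈ S)
    (hu : u ∈ S) : |G s - G u| ≤ M / h * |s - u| :=
  abs_sub_le_of_abs_hasDerivWithinAt_le hS hG.deriv hG.bound1 hs hu

lemma lip1 (hG : ScaledC2 S M h G G1 G2) (hS : S.OrdConnected) {s u : ℝ} (hs : s ∈ S)
    (hu : u ∈ S) : |G1 s - G1 u| ≤ M / h ^ 2 * |s - u| :=
  abs_sub_le_of_abs_hasDerivWithinAt_le hS hG.deriv1 hG.bound2 hs hu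

lemma mono_scale (hG : ScaledC2 S M 1 G G1 G2) (hM : 0 ≤ M) (hh : 0 < h) (h1 : h ≤ 1) :
    ScaledC2 S M h G G1 G2 where
  deriv := hG.deriv
  deriv1 := hG.deriv1
  bound := hG.bound
  bound1 s hs := (hG.bound1 s hs).trans (by gcongr)
  bound2 s hs := (hG.bound2 s hs).trans (by gcongr)
  lip2 s hs u hu := (hG.lip2 s hs u hu).trans (by gcongr)

/-- Products stay in the class. -/
lemma mul (hG : ScaledC2 S M h G G1 G2) (hH : ScaledC2 S M' h H H1 H2) (hS : S.OrdConnected)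
    (hM : 0 ≤ M) (hM' : 0 ≤ M') (hh : 0 < h) :
    ScaledC2 S (8 * M * M') h (fun s => G s * H s) (fun s => G1 s * H s + G s * H1 s)
      (fun s => G2 s * H s + 2 * (G1 s * H1 s) + G s * H2 s) where
  deriv s hs := (hG.deriv s hs).mul (hH.deriv s hs)
  deriv1 s hs := by
    have := ((hG.deriv1 s hs).mul (hH.deriv s hs)).add ((hG.deriv s hs).mul (hH.deriv1 s hs))
    refine this.congr_deriv ?_
    ring
  bound s hs := by
    rw [abs_mul]
    have := mul_le_mul (hG.bound s hs) (hH.bound s hs) (abs_nonneg _) hM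
    nlinarith [mul_nonneg hM hM']
  bound1 s hs := by
    have h1 := mul_le_mul (hG.bound1 s hs) (hH.bound s hs) (abs_nonneg _) (by positivity)
    have h2 := mul_le_mul (hG.bound s hs) (hH.bound1 s hs) (abs_nonneg _) (by positivity)
    refine (abs_add_le _ _).trans ?_
    rw [abs_mul, abs_mul]
    have h3 : M / h * M' + M * (M' / h) ≤ 8 * M * M' / h := by
      have : 0 ≤ M * M' / h := by positivity
      have e : 8 * M * M' / h - (M / h * M' + M * (M' / h)) = 6 * (M * M' / h) := by
        field_simp; ring
      linarith
    linarith
  bound2 s hs := by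
    have h1 := mul_le_mul (hG.bound2 s hs) (hH.bound s hs) (abs_nonneg _) (by positivity)
    have h2 := mul_le_mul (hG.bound s hs) (hH.bound2 s hs) (abs_nonneg _) (by positivity)
    have h3 := mul_le_mul (hG.bound1 s hs) (hH.bound1 s hs) (abs_nonneg _) (by positivity)
    have h5 : M / h ^ 2 * M' + 2 * (M / h * (M' / h)) + M * (M' / h ^ 2) ≤ 8 * M * M' / h ^ 2 := by
      have : 0 ≤ M * M' / h ^ 2 := by positivity
      have e : 8 * M * M' / h ^ 2 - (M / h ^ 2 * M' + 2 * (M / h * (M' / h)) + M * (M' / h ^ 2))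
          = 4 * (M * M' / h ^ 2) := by
        field_simp; ring
      linarith
    refine (abs_add_le _ _).trans ((add_le_add_left (abs_add_le _ _) _).trans ?_)
    rw [abs_mul, abs_mul, abs_mul, abs_mul, abs_two]
    linarith
  lip2 s hs u hu := by
    have h1 := abs_mul_sub_mul_le (hG.bound2 s hs) (hH.bound u hu) (hG.lip2 s hs u hu)
      (hH.lip0 hS hs hu)
    have h2 := abs_mul_sub_mul_le (hG.bound1 s hs) (hH.bound1 u hu) (hG.lip1 hS hs hu)
      (hH.lip1 hS hs hu)
    have h3 := abs_mul_sub_mul_le (hG.bound s hs) (hH.bound2 u hu) (hG.lip0 hS hs hu)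
      (hH.lip2 s hs u hu)
    have e : G2 s * H s + 2 * (G1 s * H1 s) + G s * H2 s
        - (G2 u * H u + 2 * (G1 u * H1 u) + G u * H2 u)
        = (G2 s * H s - G2 u * H u) + 2 * (G1 s * H1 s - G1 u * H1 u)
          + (G s * H2 s - G u * H2 u) := by ring
    rw [e]
    refine (abs_add_le _ _).trans ((add_le_add_left (abs_add_le _ _) _).trans ?_)
    rw [abs_mul 2, abs_two]
    have e2 : 8 * M * M' / h ^ 3 * |s - u| = (M / h ^ 2 * (M' / h) + M / h ^ 3 * M') * |s - u|
        + 2 * ((M / h * (M' / h ^ 2) + M / h ^ 2 * (M' / h)) * |s - u|)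
        + (M * (M' / h ^ 3) + M / h * (M' / h ^ 2)) * |s - u| := by
      field_simp; ring
    linarith

/-- On a compact interval, it suffices that the second derivative is Lipschitz. -/
lemma exists_of_lipschitz {a b L : ℝ} {G G1 G2 : ℝ → ℝ}
    (hd : ∀ s ∈ Set.Icc a b, HasDerivWithinAt G (G1 s) (Set.Icc a b) s)
    (hd1 : ∀ s ∈ Set.Icc a b, HasDerivWithinAt G1 (G2 s) (Set.Icc a b) s)
    (hL : ∀ s ∈ Set.Icc a b, ∀ u ∈ Set.Icc a b, |G2 s - G2 u| ≤ L * |s - u|) :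
    ∃ M, 0 ≤ M ∧ ScaledC2 (Set.Icc a b) M 1 G G1 G2 := by
  have hc2 : ContinuousOn G2 (Set.Icc a b) := by
    have : LipschitzOnWith (Real.toNNReal (max L 0)) G2 (Set.Icc a b) := by
      refine LipschitzOnWith.of_dist_le_mul fun s hs u hu => ?_
      rw [Real.dist_eq, Real.dist_eq, Real.coe_toNNReal _ (le_max_right _ _)]
      exact (hL s hs u hu).trans (mul_le_mul_of_nonneg_right (le_max_left _ _) (abs_nonneg _))
    exact this.continuousOn
  obtain ⟨c0, h0⟩ := isCompact_Icc.exists_bound_of_continuousOn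
    (fun s hs => (hd s hs).continuousWithinAt : ContinuousOn G (Set.Icc a b))
  obtain ⟨c1, h1⟩ := isCompact_Icc.exists_bound_of_continuousOn
    (fun s hs => (hd1 s hs).continuousWithinAt : ContinuousOn G1 (Set.Icc a b))
  obtain ⟨c2, h2⟩ := isCompact_Icc.exists_bound_of_continuousOn hc2
  simp only [Real.norm_eq_abs] at h0 h1 h2
  refine ⟨|c0| + |c1| + |c2| + |L|, by positivity, hd, hd1, fun s hs => ?_, fun s hs => ?_,
    fun s hs => ?_, fun s hs u hu => ?_⟩
  · linarith [h0 s hs, le_abs_self c0, abs_nonneg c1, abs_nonneg c2, abs_nonneg L]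
  · linarith [h1 s hs, le_abs_self c1, abs_nonneg c0, abs_nonneg c2, abs_nonneg L]
  · linarith [h2 s hs, le_abs_self c2, abs_nonneg c1, abs_nonneg c0, abs_nonneg L]
  · refine (hL s hs u hu).trans (mul_le_mul_of_nonneg_right ?_ (abs_nonneg _))
    linarith [le_abs_self L, abs_nonneg c1, abs_nonneg c2, abs_nonneg c0]

/-- A function vanishing outside `(-1, 1)` is in the class globally if its second derivative is
Lipschitz on `[-1, 1]`. -/
lemma exists_univ_of_lipschitz {L : ℝ} {k k1 k2 : ℝ → ℝ}
    (hd : ∀ s, HasDerivAt k (k1 s) s) (hd1 : ∀ s, HasDerivAt k1 (k2 s) s)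
    (hz : ∀ s, 1 ≤ |s| → k s = 0 ∧ k1 s = 0 ∧ k2 s = 0)
    (hL : ∀ s ∈ Set.Icc (-1 : ℝ) 1, ∀ u ∈ Set.Icc (-1 : ℝ) 1, |k2 s - k2 u| ≤ L * |s - u|) :
    ∃ M, 0 ≤ M ∧ ScaledC2 Set.univ M 1 k k1 k2 := by
  obtain ⟨M, hM, hk⟩ := exists_of_lipschitz (fun s _ => (hd s).hasDerivWithinAt)
    (fun s _ => (hd1 s).hasDerivWithinAt) hL
  have hmem : ∀ s, s ∈ Set.Icc (-1 : ℝ) 1 ∨ (k s = 0 ∧ k1 s = 0 ∧ k2 s = 0) := by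
    intro s
    by_cases h : |s| ≤ 1
    · exact Or.inl (abs_le.1 h)
    · exact Or.inr (hz s (not_le.1 h).le)
  have hproj : ∀ s, ∃ p ∈ Set.Icc (-1 : ℝ) 1, k2 p = k2 s ∧ p = max (-1) (min 1 s) := by
    intro s
    refine ⟨max (-1) (min 1 s), ⟨le_max_left _ _, max_le (by norm_num) (min_le_left _ _)⟩, ?_, rfl⟩
    rcases le_total s (-1) with h | h
    · have : max (-1) (min 1 s) = -1 := by
        rw [min_eq_right (by linarith), max_eq_left h]
      rw [this, (hz (-1) (by simp)).2.2, (hz s (by rw [abs_of_nonpos (by linarith)]; linarith)).2.2]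
    rcases le_total s 1 with h' | h'
    · rw [min_eq_right h', max_eq_right h]
    · rw [min_eq_left h', max_eq_right (by norm_num), (hz 1 (by simp)).2.2,
        (hz s (h'.trans (le_abs_self s))).2.2]
  refine ⟨M, hM, fun s _ => (hd s).hasDerivWithinAt, fun s _ => (hd1 s).hasDerivWithinAt,
    fun s _ => ?_, fun s _ => ?_, fun s _ => ?_, fun s _ u _ => ?_⟩
  · rcases hmem s with h | h
    · exact hk.bound s h
    · simpa [h.1] using hM
  · rcases hmem s with h | h
    · exact hk.bound1 s h
    · simpa [h.2.1] using hM
  · rcases hmem s with h | h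
    · exact hk.bound2 s h
    · simpa [h.2.2] using hM
  · obtain ⟨p, hp, hps, hpe⟩ := hproj s
    obtain ⟨q, hq, hqu, hqe⟩ := hproj u
    rw [← hps, ← hqu]
    refine (hk.lip2 p hp q hq).trans (mul_le_mul_of_nonneg_left ?_ (by positivity))
    rw [hpe, hqe]
    refine (abs_max_sub_max_le_max _ _ _ _).trans ?_
    refine max_le (by simp) ((abs_min_sub_min_le_max _ _ _ _).trans (max_le (by simp) le_rfl))

/-- Rescaling a kernel. -/
lemma comp_rescale {k k1 k2 : ℝ → ℝ} (hk : ScaledC2 Set.univ M 1 k k1 k2) (x : ℝ) (hh : 0 < h)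
    (S : Set ℝ) :
    ScaledC2 S M h (fun s => k ((x - s) / h)) (fun s => -(1 / h) * k1 ((x - s) / h))
      (fun s => (1 / h ^ 2) * k2 ((x - s) / h)) := by
  have hy : ∀ s, HasDerivAt (fun s => (x - s) / h) (-(1 / h)) s := by
    intro s
    have := ((hasDerivAt_id s).const_sub x).div_const h
    refine this.congr_deriv (by ring)
  have h0 : ∀ y, HasDerivAt k (k1 y) y := fun y => hasDerivWithinAt_univ.1 (hk.deriv y trivial)
  have h1 : ∀ y, HasDerivAt k1 (k2 y) y := fun y => hasDerivWithinAt_univ.1 (hk.deriv1 y trivial)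
  refine ⟨fun s _ => ?_, fun s _ => ?_, fun s _ => hk.bound _ trivial, fun s _ => ?_,
    fun s _ => ?_, fun s _ u _ => ?_⟩
  · refine (((h0 _).comp s (hy s)).congr_deriv (by ring)).hasDerivWithinAt
  · refine ((((h1 _).comp s (hy s)).const_mul (-(1 / h))).congr_deriv (by ring)).hasDerivWithinAt
  · have := hk.bound1 ((x - s) / h) trivial
    rw [abs_mul, abs_neg, abs_of_pos (by positivity : 0 < 1 / h), div_one] at *
    calc 1 / h * |k1 ((x - s) / h)| ≤ 1 / h * M := by gcongr
      _ = M / h := by ring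
  · have := hk.bound2 ((x - s) / h) trivial
    rw [abs_mul, abs_of_pos (by positivity : 0 < 1 / h ^ 2)]
    calc 1 / h ^ 2 * |k2 ((x - s) / h)| ≤ 1 / h ^ 2 * (M / 1 ^ 2) := by gcongr
      _ = M / h ^ 2 := by ring
  · have := hk.lip2 ((x - s) / h) trivial ((x - u) / h) trivial
    rw [← mul_sub, abs_mul, abs_of_pos (by positivity : 0 < 1 / h ^ 2)]
    have e : |(x - s) / h - (x - u) / h| = |s - u| / h := by
      rw [← sub_div, abs_div, abs_of_pos hh, abs_sub_comm]; congr 2; ring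
    rw [e] at this
    calc 1 / h ^ 2 * |k2 ((x - s) / h) - k2 ((x - u) / h)|
        ≤ 1 / h ^ 2 * (M / 1 ^ 3 * (|s - u| / h)) := by gcongr
      _ = M / h ^ 3 * |s - u| := by field_simp

end ScaledC2

/-- Bounded and Lipschitz on `S`. -/
def BddLipOn (S : Set ℝ) (a : ℝ → ℝ) : Prop :=
  ∃ B L : ℝ, (∀ s ∈ S, |a s| ≤ B) ∧ ∀ s ∈ S, ∀ u ∈ S, |a s - a u| ≤ L * |s - u|

namespace BddLipOn

variable {S : Set ℝ} {a b : ℝ → ℝ}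

lemma mul (ha : BddLipOn S a) (hb : BddLipOn S b) : BddLipOn S (fun s => a s * b s) := by
  obtain ⟨A, A', hA, hA'⟩ := ha
  obtain ⟨B, B', hB, hB'⟩ := hb
  refine ⟨A * B, A * B' + A' * B, fun s hs => ?_, fun s hs u hu => ?_⟩
  · rw [abs_mul]
    exact mul_le_mul (hA s hs) (hB s hs) (abs_nonneg _) ((abs_nonneg _).trans (hA s hs))
  · exact abs_mul_sub_mul_le (hA s hs) (hB u hu) (hA' s hs u hu) (hB' s hs u hu)

lemma add (ha : BddLipOn S a) (hb : BddLipOn S b) : BddLipOn S (fun s => a s + b s) := by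
  obtain ⟨A, A', hA, hA'⟩ := ha
  obtain ⟨B, B', hB, hB'⟩ := hb
  refine ⟨A + B, A' + B', fun s hs => ?_, fun s hs u hu => ?_⟩
  · exact (abs_add_le _ _).trans (add_le_add (hA s hs) (hB s hs))
  · have e : a s + b s - (a u + b u) = (a s - a u) + (b s - b u) := by ring
    rw [e, add_mul]
    exact (abs_add_le _ _).trans (add_le_add (hA' s hs u hu) (hB' s hs u hu))

lemma const_mul (c : ℝ) (ha : BddLipOn S a) : BddLipOn S (fun s => c * a s) :=
  mul ⟨|c|, 0, fun _ _ => le_rfl, fun _ _ _ _ => by simp⟩ ha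

end BddLipOn

namespace ScaledC2

variable {S : Set ℝ} {M : ℝ} {G G1 G2 : ℝ → ℝ}

lemma bddLipOn1 (hG : ScaledC2 S M 1 G G1 G2) (hS : S.OrdConnected) : BddLipOn S G1 :=
  ⟨_, _, hG.bound1, fun _ hs _ hu => hG.lip1 hS hs hu⟩

lemma bddLipOn2 (hG : ScaledC2 S M 1 G G1 G2) : BddLipOn S G2 :=
  ⟨_, _, hG.bound2, hG.lip2⟩

/-- The reciprocal of a function bounded below stays in the class. -/
lemma exists_inv {a b c : ℝ} {f f1 f2 : ℝ → ℝ} (hf : ScaledC2 (Set.Icc a b) M 1 f f1 f2)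
    (hc : 0 < c) (hlb : ∀ s ∈ Set.Icc a b, c ≤ f s) :
    ∃ M' i1 i2, 0 ≤ M' ∧ ScaledC2 (Set.Icc a b) M' 1 (fun s => (f s)⁻¹) i1 i2 := by
  have hS : (Set.Icc a b).OrdConnected := Set.ordConnected_Icc
  have hpos : ∀ s ∈ Set.Icc a b, 0 < f s := fun s hs => hc.trans_le (hlb s hs)
  have hinv : BddLipOn (Set.Icc a b) (fun s => (f s)⁻¹) := by
    refine ⟨c⁻¹, M / (c * c), fun s hs => ?_, fun s hs u hu => ?_⟩
    · rw [abs_of_pos (inv_pos.2 (hpos s hs))]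
      exact inv_anti₀ hc (hlb s hs)
    · have h1 := hpos s hs
      have h2 := hpos u hu
      have e : (f s)⁻¹ - (f u)⁻¹ = (f u - f s) / (f s * f u) := by field_simp
      rw [e, abs_div, abs_of_pos (mul_pos h1 h2), abs_sub_comm]
      have h3 := hf.lip0 hS hs hu
      rw [div_one] at h3
      calc |f s - f u| / (f s * f u) ≤ (M * |s - u|) / (c * c) := by
            have := hlb s hs
            have := hlb u hu
            have h0 := (abs_nonneg _).trans h3
            gcongr
        _ = M / (c * c) * |s - u| := by ring
  have hd : ∀ s ∈ Set.Icc a b, HasDerivWithinAt (fun s => (f s)⁻¹)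
      (-(f1 s) * ((f s)⁻¹ * (f s)⁻¹)) (Set.Icc a b) s := by
    intro s hs
    refine ((hf.deriv s hs).fun_inv (hpos s hs).ne').congr_deriv ?_
    have := (hpos s hs).ne'
    field_simp
  have hd1 : ∀ s ∈ Set.Icc a b, HasDerivWithinAt (fun s => -(f1 s) * ((f s)⁻¹ * (f s)⁻¹))
      ((-1) * (f2 s * ((f s)⁻¹ * (f s)⁻¹))
        + 2 * ((f1 s * f1 s) * ((f s)⁻¹ * ((f s)⁻¹ * (f s)⁻¹)))) (Set.Icc a b) s := by
    intro s hs
    refine ((hf.deriv1 s hs).fun_neg.fun_mul ((hd s hs).fun_mul (hd s hs))).congr_deriv ?_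
    ring
  have hL : BddLipOn (Set.Icc a b) (fun s => (-1) * (f2 s * ((f s)⁻¹ * (f s)⁻¹))
        + 2 * ((f1 s * f1 s) * ((f s)⁻¹ * ((f s)⁻¹ * (f s)⁻¹)))) :=
    ((hf.bddLipOn2.mul (hinv.mul hinv)).const_mul (-1)).add
      ((((hf.bddLipOn1 hS).mul (hf.bddLipOn1 hS)).mul (hinv.mul (hinv.mul hinv))).const_mul 2)
  obtain ⟨_, L, _, hL⟩ := hL
  obtain ⟨M', hM', h⟩ := exists_of_lipschitz hd hd1 hL
  exact ⟨M', _, _, hM', h⟩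

end ScaledC2

/-- Corrected trapezoidal rule on one cell, in the time scale `F`. -/
lemma abs_trapezoid_cell_le {F Γ f G H p : ℝ → ℝ} {a b N L : ℝ} (hab : a ≤ b)
    (hN : ∀ s ∈ Set.Icc a b, |f s| ≤ N) (hL0 : 0 ≤ L)
    (hFc : ContinuousOn F (Set.Icc a b)) (hΓc : ContinuousOn Γ (Set.Icc a b))
    (hGc : ContinuousOn G (Set.Icc a b)) (hHc : ContinuousOn H (Set.Icc a b))
    (hF : ∀ s ∈ Set.Ioo a b, HasDerivAt F (f s) s)
    (hΓ : ∀ s ∈ Set.Ioo a b, HasDerivAt Γ (G s * f s) s)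
    (hG : ∀ s ∈ Set.Ioo a b, HasDerivAt G (f s * H s) s)
    (hH : ∀ s ∈ Set.Ioo a b, HasDerivAt H (f s * p s) s)
    (hp : ∀ s ∈ Set.Icc a b, |p s - p a| ≤ L * (s - a)) :
    |(F b - F a) / 2 * (G a + G b) - (Γ b - Γ a) - (F b - F a) ^ 2 / 12 * (H b - H a)|
      ≤ N ^ 3 * L * (b - a) ^ 4 := by
  have hN0 : 0 ≤ N := (abs_nonneg _).trans (hN a ⟨le_rfl, hab⟩)
  have hd0 : 0 ≤ b - a := sub_nonneg.2 hab
  have hsub : ∀ s ∈ Set.Icc a b, Set.Icc a s ⊆ Set.Icc a b :=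
    fun s hs => Set.Icc_subset_Icc_right hs.2
  have hsubo : ∀ s ∈ Set.Icc a b, Set.Ioo a s ⊆ Set.Ioo a b :=
    fun s hs => Set.Ioo_subset_Ioo_right hs.2
  have hmem : ∀ s ∈ Set.Ioo a b, s ∈ Set.Icc a b := fun s hs => Set.Ioo_subset_Icc_self hs
  have hpb : ∀ s ∈ Set.Icc a b, |p s - p a| ≤ L * (b - a) := fun s hs =>
    (hp s hs).trans (mul_le_mul_of_nonneg_left (by linarith [hs.2]) hL0)
  have hβ : ∀ s ∈ Set.Icc a b, |F s - F a| ≤ N * (b - a) := by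
    intro s hs
    refine (abs_sub_le_of_abs_hasDerivAt_le hs.1 (hFc.mono (hsub s hs))
      (fun u hu => hF u (hsubo s hs hu))
      (fun u hu => hN u (hmem u (hsubo s hs hu)))).trans ?_
    exact mul_le_mul_of_nonneg_left (by linarith [hs.2]) hN0
  have hHb : ∀ s ∈ Set.Icc a b, |H s - H a - (F s - F a) * p a| ≤ N * L * (b - a) ^ 2 := by
    intro s hs
    have := abs_sub_le_of_abs_hasDerivAt_le (e := fun u => H u - F u * p a)
      (e' := fun u => f u * (p u - p a)) (B := N * (L * (b - a))) hs.1
      ((hHc.mono (hsub s hs)).sub ((hFc.mono (hsub s hs)).mul continuousOn_const))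
      (fun u hu => ((hH u (hsubo s hs hu)).sub
        ((hF u (hsubo s hs hu)).mul_const (p a))).congr_deriv (by ring))
      (fun u hu => by
        rw [abs_mul]
        have hu' := hmem u (hsubo s hs hu)
        exact mul_le_mul (hN u hu') (hpb u hu') (abs_nonneg _) hN0)
    have e : H s - H a - (F s - F a) * p a = (H s - F s * p a) - (H a - F a * p a) := by ring
    rw [e]
    refine this.trans ?_
    have : N * (L * (b - a)) * (s - a) ≤ N * (L * (b - a)) * (b - a) :=
      mul_le_mul_of_nonneg_left (by linarith [hs.2]) (by positivity)
    nlinarith [this]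
  have hE1 : ∀ s ∈ Set.Icc a b, |(G a - G s) / 2 + (F s - F a) / 2 * H s
      - (F s - F a) / 6 * (H s - H a) - (F s - F a) ^ 2 / 12 * p a|
        ≤ N ^ 2 * L * (b - a) ^ 3 / 2 := by
    intro s hs
    have := abs_sub_le_of_abs_hasDerivAt_le
      (e := fun s => (G a - G s) / 2 + (F s - F a) / 2 * H s
        - (F s - F a) / 6 * (H s - H a) - (F s - F a) ^ 2 / 12 * p a)
      (e' := fun s => f s * ((F s - F a) / 3 * (p s - p a)
        - (1 / 6) * (H s - H a - (F s - F a) * p a)))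
      (B := N * (N * L * (b - a) ^ 2 / 2)) hs.1
      (by
        have h1 := hFc.mono (hsub s hs)
        have h2 := hGc.mono (hsub s hs)
        have h3 := hHc.mono (hsub s hs)
        fun_prop)
      (fun u hu => by
        have h1 := hF u (hsubo s hs hu)
        have h2 := hG u (hsubo s hs hu)
        have h3 := hH u (hsubo s hs hu)
        refine ((((h2.const_sub (G a)).div_const 2).add
          (((h1.sub_const (F a)).div_const 2).mul h3)).sub
          (((h1.sub_const (F a)).div_const 6).mul (h3.sub_const (H a)))).sub
          ((((h1.sub_const (F a)).fun_pow 2).div_const 12).mul_const (p a)) |>.congr_deriv ?_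
        simp only [Nat.cast_ofNat, Nat.add_one_sub_one, pow_one]
        ring)
      (fun u hu => by
        have hu' := hmem u (hsubo s hs hu)
        rw [abs_mul]
        refine mul_le_mul (hN u hu') ?_ (abs_nonneg _) hN0
        refine (abs_sub _ _).trans ?_
        rw [abs_mul, abs_mul, abs_div]
        have h1 := mul_le_mul (hβ u hu') (hpb u hu') (abs_nonneg _) (by positivity)
        have h2 := hHb u hu'
        rw [abs_of_pos (by norm_num : (0:ℝ) < 3), abs_of_pos (by norm_num : (0:ℝ) < 1 / 6)]
        have e : |F u - F a| / 3 * |p u - p a| = (|F u - F a| * |p u - p a|) / 3 := by ring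
        rw [e]
        have : N * (b - a) * (L * (b - a)) = N * L * (b - a) ^ 2 := by ring
        linarith)
    simp only [sub_self, zero_div, zero_mul, add_zero, ne_eq, OfNat.ofNat_ne_zero,
      not_false_eq_true, zero_pow, sub_zero] at this
    refine this.trans ?_
    have h3 : N * (N * L * (b - a) ^ 2 / 2) * (s - a) ≤ N * (N * L * (b - a) ^ 2 / 2) * (b - a) :=
      mul_le_mul_of_nonneg_left (by linarith [hs.2]) (by positivity)
    refine h3.trans (le_of_eq (by ring))
  have := abs_sub_le_of_abs_hasDerivAt_le
      (e := fun s => (F s - F a) / 2 * (G a + G s) - (Γ s - Γ a)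
        - (F s - F a) ^ 2 / 12 * (H s - H a))
      (e' := fun s => f s * (((G a - G s) / 2 + (F s - F a) / 2 * H s
        - (F s - F a) / 6 * (H s - H a) - (F s - F a) ^ 2 / 12 * p a)
        - (F s - F a) ^ 2 / 12 * (p s - p a)))
      (B := N * (N ^ 2 * L * (b - a) ^ 3)) hab (by fun_prop)
      (fun u hu => by
        have h1 := hF u hu
        have h2 := hG u hu
        have h3 := hH u hu
        refine ((((h1.sub_const (F a)).div_const 2).mul (h2.const_add (G a))).sub
          ((hΓ u hu).sub_const (Γ a))).sub
          ((((h1.sub_const (F a)).fun_pow 2).div_const 12).mul (h3.sub_const (H a))) |>.congr_deriv ?_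
        simp only [Nat.cast_ofNat, Nat.add_one_sub_one, pow_one]
        ring)
      (fun u hu => by
        have hu' := hmem u hu
        rw [abs_mul]
        refine mul_le_mul (hN u hu') ?_ (abs_nonneg _) hN0
        refine (abs_sub _ _).trans ?_
        have h1 : |F u - F a| ^ 2 * |p u - p a| ≤ (N * (b - a)) ^ 2 * (L * (b - a)) :=
          mul_le_mul (pow_le_pow_left₀ (abs_nonneg _) (hβ u hu') 2) (hpb u hu') (abs_nonneg _)
            (by positivity)
        have h2 := hE1 u hu'
        rw [abs_mul, abs_div, abs_pow, abs_of_pos (by norm_num : (0:ℝ) < 12)]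
        have e : |F u - F a| ^ 2 / 12 * |p u - p a| = (|F u - F a| ^ 2 * |p u - p a|) / 12 := by
          ring
        have e2 : (N * (b - a)) ^ 2 * (L * (b - a)) = N ^ 2 * L * (b - a) ^ 3 := by ring
        have : 0 ≤ N ^ 2 * L * (b - a) ^ 3 := by positivity
        rw [e]
        linarith)
  simp only [sub_self, zero_div, zero_mul, ne_eq, OfNat.ofNat_ne_zero,
      not_false_eq_true, zero_pow, sub_zero] at this
  refine this.trans (le_of_eq (by ring))

/-- A density on `[0, 1]`, continuous with values in `[c, N]`. -/
structure BoundedDensity (f : ℝ → ℝ) (c N : ℝ) : Prop where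
  pos : 0 < c
  cont : ContinuousOn f (Set.Icc 0 1)
  lower : ∀ s ∈ Set.Icc (0 : ℝ) 1, c ≤ f s
  upper : ∀ s ∈ Set.Icc (0 : ℝ) 1, f s ≤ N

/-- The points `τ 0 = 0, τ 1, …, τ n` are the `i / n`-quantiles of the density `f`. -/
structure IsQuantileGrid (f : ℝ → ℝ) (n : ℕ) (τ : ℕ → ℝ) : Prop where
  pos : 0 < n
  zero : τ 0 = 0
  last : τ n = 1
  mem : ∀ i ≤ n, τ i ∈ Set.Icc (0 : ℝ) 1
  cdf : ∀ i ≤ n, ∫ s in (0 : ℝ)..(τ i), f s = (i : ℝ) / n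

lemma intervalIntegrable_of_continuousOn_unit {φ : ℝ → ℝ} (hφ : ContinuousOn φ (Set.Icc 0 1))
    {a b : ℝ} (ha : a ∈ Set.Icc (0 : ℝ) 1) (hb : b ∈ Set.Icc (0 : ℝ) 1) :
    IntervalIntegrable φ volume a b :=
  (hφ.mono (Set.uIcc_subset_Icc ha hb)).intervalIntegrable

lemma hasDerivAt_integral_of_continuousOn_unit {φ : ℝ → ℝ} (hφ : ContinuousOn φ (Set.Icc 0 1))
    {s : ℝ} (hs : s ∈ Set.Ioo (0 : ℝ) 1) :
    HasDerivAt (fun u => ∫ v in (0 : ℝ)..u, φ v) (φ s) s := by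
  have hnhds : Set.Icc (0 : ℝ) 1 ∈ 𝓝 s := Icc_mem_nhds hs.1 hs.2
  refine intervalIntegral.integral_hasDerivAt_right
    (intervalIntegrable_of_continuousOn_unit hφ ⟨le_rfl, zero_le_one⟩
      (Set.Ioo_subset_Icc_self hs)) ?_ (hφ.continuousAt hnhds)
  exact hφ.stronglyMeasurableAtFilter_nhdsWithin measurableSet_Icc s |>.filter_mono
    (le_of_eq (nhdsWithin_eq_nhds.2 hnhds).symm)

lemma continuousOn_integral_of_continuousOn_unit {φ : ℝ → ℝ}
    (hφ : ContinuousOn φ (Set.Icc 0 1)) :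
    ContinuousOn (fun u => ∫ v in (0 : ℝ)..u, φ v) (Set.Icc 0 1) := by
  have := intervalIntegral.continuousOn_primitive_interval (f := φ) (μ := volume) (a := 0) (b := 1)
    (by rw [Set.uIcc_of_le zero_le_one]; exact hφ.integrableOn_Icc)
  rwa [Set.uIcc_of_le zero_le_one] at this

lemma integral_sub_integral_unit {φ : ℝ → ℝ} (hφ : ContinuousOn φ (Set.Icc 0 1))
    {a b : ℝ} (ha : a ∈ Set.Icc (0 : ℝ) 1) (hb : b ∈ Set.Icc (0 : ℝ) 1) :
    (∫ v in (0 : ℝ)..b, φ v) - ∫ v in (0 : ℝ)..a, φ v = ∫ v in a..b, φ v :=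
  intervalIntegral.integral_interval_sub_left
    (intervalIntegrable_of_continuousOn_unit hφ ⟨le_rfl, zero_le_one⟩ hb)
    (intervalIntegrable_of_continuousOn_unit hφ ⟨le_rfl, zero_le_one⟩ ha)

namespace BoundedDensity

variable {f : ℝ → ℝ} {c N : ℝ}

lemma nonneg (hf : BoundedDensity f c N) : 0 ≤ N :=
  hf.pos.le.trans ((hf.lower 0 ⟨le_rfl, zero_le_one⟩).trans (hf.upper 0 ⟨le_rfl, zero_le_one⟩))

lemma abs_le (hf : BoundedDensity f c N) {s : ℝ} (hs : s ∈ Set.Icc (0 : ℝ) 1) : |f s| ≤ N := by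
  rw [abs_of_pos (hf.pos.trans_le (hf.lower s hs))]
  exact hf.upper s hs

lemma le_integral (hf : BoundedDensity f c N) {a b : ℝ} (ha : a ∈ Set.Icc (0 : ℝ) 1)
    (hb : b ∈ Set.Icc (0 : ℝ) 1) (hab : a ≤ b) : c * (b - a) ≤ ∫ v in a..b, f v := by
  have := intervalIntegral.integral_mono_on (f := fun _ => c) (g := f) (μ := volume) hab (by simp)
    (intervalIntegrable_of_continuousOn_unit hf.cont ha hb)
    (fun s hs => hf.lower s ⟨ha.1.trans hs.1, hs.2.trans hb.2⟩)
  simpa [mul_comm] using this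

lemma integral_le (hf : BoundedDensity f c N) {a b : ℝ} (ha : a ∈ Set.Icc (0 : ℝ) 1)
    (hb : b ∈ Set.Icc (0 : ℝ) 1) (hab : a ≤ b) : ∫ v in a..b, f v ≤ N * (b - a) := by
  have := intervalIntegral.integral_mono_on (f := f) (g := fun _ => N) (μ := volume) hab
    (intervalIntegrable_of_continuousOn_unit hf.cont ha hb) (by simp)
    (fun s hs => hf.upper s ⟨ha.1.trans hs.1, hs.2.trans hb.2⟩)
  simpa [mul_comm] using this

end BoundedDensity

/-- A finite set of naturals in a real interval has few elements. -/
lemma card_le_of_mem_real_Icc {S : Finset ℕ} {a b : ℝ} (hab : a ≤ b)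
    (h : ∀ i ∈ S, a ≤ (i : ℝ) ∧ (i : ℝ) ≤ b) : (S.card : ℝ) ≤ b - a + 1 := by
  rcases S.eq_empty_or_nonempty with rfl | hne
  · simp; linarith
  · have hsub : S ⊆ Finset.Icc (S.min' hne) (S.max' hne) := fun i hi =>
      Finset.mem_Icc.2 ⟨S.min'_le i hi, S.le_max' i hi⟩
    have hle : S.min' hne ≤ S.max' hne := S.min'_le _ (S.max'_mem hne)
    have h1 := Finset.card_le_card hsub
    rw [Nat.card_Icc] at h1
    have h2 : S.card + S.min' hne ≤ S.max' hne + 1 := by omega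
    have h3 : (S.card : ℝ) + (S.min' hne : ℕ) ≤ (S.max' hne : ℕ) + 1 := by exact_mod_cast h2
    linarith [(h _ (S.min'_mem hne)).1, (h _ (S.max'_mem hne)).2]

namespace IsQuantileGrid

variable {f : ℝ → ℝ} {c N : ℝ} {n : ℕ} {τ : ℕ → ℝ}

lemma integral_eq (hτ : IsQuantileGrid f n τ) (hf : BoundedDensity f c N) {i j : ℕ} (hi : i ≤ n)
    (hj : j ≤ n) : ∫ v in (τ i)..(τ j), f v = ((j : ℝ) - i) / n := by
  rw [← integral_sub_integral_unit hf.cont (hτ.mem i hi) (hτ.mem j hj), hτ.cdf i hi, hτ.cdf j hj]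
  ring

lemma mono (hτ : IsQuantileGrid f n τ) (hf : BoundedDensity f c N) {i j : ℕ} (hij : i ≤ j)
    (hj : j ≤ n) : τ i ≤ τ j := by
  by_contra hlt
  push Not at hlt
  have h1 := hf.le_integral (hτ.mem j hj) (hτ.mem i (hij.trans hj)) hlt.le
  rw [hτ.integral_eq hf hj (hij.trans hj)] at h1
  have h2 : ((i : ℝ) - j) / n ≤ 0 :=
    div_nonpos_of_nonpos_of_nonneg (by simpa using hij) (Nat.cast_nonneg _)
  have := mul_pos hf.pos (sub_pos.2 hlt)
  linarith

lemma step_le (hτ : IsQuantileGrid f n τ) (hf : BoundedDensity f c N) {i : ℕ} (hi : i + 1 ≤ n) :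
    τ (i + 1) - τ i ≤ 1 / (c * n) := by
  have h1 := hf.le_integral (hτ.mem i (by omega)) (hτ.mem (i + 1) hi)
    (hτ.mono hf (Nat.le_succ i) hi)
  rw [hτ.integral_eq hf (by omega) hi] at h1
  have hn : (0 : ℝ) < n := by exact_mod_cast hτ.pos
  have hc := hf.pos
  rw [le_div_iff₀ (by positivity)]
  push_cast at h1
  rw [le_div_iff₀ hn] at h1
  linarith

/-- The cells meeting `(x - h, x + h)` are at most of order `n h`. -/
lemma card_le (hτ : IsQuantileGrid f n τ) (hf : BoundedDensity f c N) {x h : ℝ} (hh : 0 < h)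
    (hnh : 1 ≤ (n : ℝ) * h) (hw : Set.Icc (x - h) (x + h) ⊆ Set.Icc (0 : ℝ) 1) {S : Finset ℕ}
    (hS : ∀ i ∈ S, i ≤ n ∧ τ i ≤ x + h ∧ (x - h ≤ τ i ∨ i + 1 ≤ n ∧ x - h ≤ τ (i + 1))) :
    (S.card : ℝ) ≤ (2 * N + 2) * (n * h) := by
  have ha := hw (Set.left_mem_Icc.2 (by linarith))
  have hb := hw (Set.right_mem_Icc.2 (by linarith))
  have hn : (0 : ℝ) < n := by exact_mod_cast hτ.pos
  have h0 : (0 : ℝ) ∈ Set.Icc (0 : ℝ) 1 := ⟨le_rfl, zero_le_one⟩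
  have hF : ∀ s ∈ Set.Icc (0 : ℝ) 1, ∀ u ∈ Set.Icc (0 : ℝ) 1, s ≤ u →
      ∫ v in (0 : ℝ)..s, f v ≤ ∫ v in (0 : ℝ)..u, f v := by
    intro s hs u hu hsu
    have h1 := hf.le_integral hs hu hsu
    rw [← integral_sub_integral_unit hf.cont hs hu] at h1
    linarith [mul_nonneg hf.pos.le (sub_nonneg.2 hsu)]
  have hlen := hf.integral_le ha hb (by linarith)
  rw [← integral_sub_integral_unit hf.cont ha hb] at hlen
  have hmono := hF _ ha _ hb (by linarith)
  have key := card_le_of_mem_real_Icc (S := S) (a := n * (∫ v in (0 : ℝ)..(x - h), f v) - 1)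
    (b := n * ∫ v in (0 : ℝ)..(x + h), f v) (by nlinarith) (by
      intro i hi
      obtain ⟨hin, hiu, hil⟩ := hS i hi
      have e1 : (n : ℝ) * ∫ v in (0 : ℝ)..(τ i), f v = i := by
        rw [hτ.cdf i hin]; field_simp
      constructor
      · rcases hil with hil | ⟨hin', hil⟩
        · have := mul_le_mul_of_nonneg_left (hF _ ha _ (hτ.mem i hin) hil) hn.le
          linarith
        · have := mul_le_mul_of_nonneg_left (hF _ ha _ (hτ.mem _ hin') hil) hn.le
          have e2 : (n : ℝ) * ∫ v in (0 : ℝ)..(τ (i + 1)), f v = i + 1 := by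
            rw [hτ.cdf _ hin']; push_cast; field_simp
          linarith
      · have := mul_le_mul_of_nonneg_left (hF _ (hτ.mem i hin) _ hb hiu) hn.le
        linarith)
  have h5 := mul_le_mul_of_nonneg_left hlen hn.le
  nlinarith [h5]

end IsQuantileGrid

/-- Corrected trapezoidal rule on a quantile grid for functions living at scale `h`. -/
theorem abs_trapezoid_sum_le {f i1 i2 G G1 G2 : ℝ → ℝ} {τ : ℕ → ℝ} {n : ℕ} {c N Mi M x h : ℝ}
    (hf : BoundedDensity f c N) (hi : ScaledC2 (Set.Icc 0 1) Mi 1 (fun s => (f s)⁻¹) i1 i2)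
    (hMi : 0 ≤ Mi) (hτ : IsQuantileGrid f n τ) (hh : 0 < h) (h1 : h ≤ 1) (hM : 0 ≤ M)
    (hnh : 1 ≤ (n : ℝ) * h) (hw : Set.Icc (x - h) (x + h) ⊆ Set.Icc (0 : ℝ) 1)
    (hG : ScaledC2 (Set.Icc 0 1) M h G G1 G2)
    (hz : ∀ s, h ≤ |x - s| → G s = 0 ∧ G1 s = 0) {p q : ℕ} (hpq : p ≤ q) (hq : q ≤ n) :
    |∑ i ∈ Finset.Ico p q, (1 / (2 * (n : ℝ))) * (G (τ i) + G (τ (i + 1)))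
        - (∫ s in (τ p)..(τ q), G s * f s)
        - 1 / (12 * (n : ℝ) ^ 2) * (G1 (τ q) * (f (τ q))⁻¹ - G1 (τ p) * (f (τ p))⁻¹)|
      ≤ ((2 * N + 2) * (N ^ 3 * (6 * Mi ^ 2)) / c ^ 4) * M * (1 / ((n : ℝ) ^ 3 * h ^ 2)) := by
  have hn : (0 : ℝ) < n := by exact_mod_cast hτ.pos
  have hS : (Set.Icc (0 : ℝ) 1).OrdConnected := Set.ordConnected_Icc
  have hc := hf.pos
  have hN := hf.nonneg
  have hGc : ContinuousOn G (Set.Icc 0 1) := fun s hs => (hG.deriv s hs).continuousWithinAt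
  have hG1c : ContinuousOn G1 (Set.Icc 0 1) := fun s hs => (hG.deriv1 s hs).continuousWithinAt
  have hGf : ContinuousOn (fun s => G s * f s) (Set.Icc 0 1) := hGc.mul hf.cont
  set cell : ℕ → ℝ := fun i => (1 / (2 * (n : ℝ))) * (G (τ i) + G (τ (i + 1)))
    - (∫ s in (τ i)..(τ (i + 1)), G s * f s)
    - 1 / (12 * (n : ℝ) ^ 2) * (G1 (τ (i + 1)) * (f (τ (i + 1)))⁻¹ - G1 (τ i) * (f (τ i))⁻¹)
    with hcell
  have hsum : ∑ i ∈ Finset.Ico p q, (1 / (2 * (n : ℝ))) * (G (τ i) + G (τ (i + 1)))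
        - (∫ s in (τ p)..(τ q), G s * f s)
        - 1 / (12 * (n : ℝ) ^ 2) * (G1 (τ q) * (f (τ q))⁻¹ - G1 (τ p) * (f (τ p))⁻¹)
      = ∑ i ∈ Finset.Ico p q, cell i := by
    induction q, hpq using Nat.le_induction with
    | base => simp
    | succ q hpq ih =>
      rw [Finset.sum_Ico_succ_top hpq, Finset.sum_Ico_succ_top hpq, ← ih (by omega),
        ← intervalIntegral.integral_add_adjacent_intervals
          (intervalIntegrable_of_continuousOn_unit hGf (hτ.mem p (by omega)) (hτ.mem q (by omega)))
          (intervalIntegrable_of_continuousOn_unit hGf (hτ.mem q (by omega)) (hτ.mem (q + 1) hq))]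
      simp only [hcell]
      ring
  have hL : ∀ s ∈ Set.Icc (0 : ℝ) 1, ∀ u ∈ Set.Icc (0 : ℝ) 1,
      |(G2 s * ((f s)⁻¹ * (f s)⁻¹) + G1 s * (i1 s * (f s)⁻¹))
        - (G2 u * ((f u)⁻¹ * (f u)⁻¹) + G1 u * (i1 u * (f u)⁻¹))|
        ≤ 6 * M * Mi ^ 2 / h ^ 3 * |s - u| := by
    intro s hs u hu
    have b0 := fun v hv => hi.bound v hv
    have b1 := fun v hv => hi.bound1 v hv
    have l0 := hi.lip0 hS hs hu
    have l1 := hi.lip1 hS hs hu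
    simp only [one_pow, div_one] at b0 b1 l0 l1
    have hii := abs_mul_sub_mul_le (b0 s hs) (b0 u hu) l0 l0
    have hi1i := abs_mul_sub_mul_le (b1 s hs) (b0 u hu) l1 l0
    have bii : |(f u)⁻¹ * (f u)⁻¹| ≤ Mi * Mi := by
      rw [abs_mul]; exact mul_le_mul (b0 u hu) (b0 u hu) (abs_nonneg _) hMi
    have bi1i : |i1 u * (f u)⁻¹| ≤ Mi * Mi := by
      rw [abs_mul]; exact mul_le_mul (b1 u hu) (b0 u hu) (abs_nonneg _) hMi
    have t1 := abs_mul_sub_mul_le (hG.bound2 s hs) bii (hG.lip2 s hs u hu) hii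
    have t2 := abs_mul_sub_mul_le (hG.bound1 s hs) bi1i (hG.lip1 hS hs hu) hi1i
    have e : (G2 s * ((f s)⁻¹ * (f s)⁻¹) + G1 s * (i1 s * (f s)⁻¹))
        - (G2 u * ((f u)⁻¹ * (f u)⁻¹) + G1 u * (i1 u * (f u)⁻¹))
        = (G2 s * ((f s)⁻¹ * (f s)⁻¹) - G2 u * ((f u)⁻¹ * (f u)⁻¹))
          + (G1 s * (i1 s * (f s)⁻¹) - G1 u * (i1 u * (f u)⁻¹)) := by ring
    rw [e]
    refine (abs_add_le _ _).trans ((add_le_add t1 t2).trans ?_)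
    rw [← add_mul]
    refine mul_le_mul_of_nonneg_right ?_ (abs_nonneg _)
    have k1 : M / h ^ 2 ≤ M / h ^ 3 := div_le_div_of_nonneg_left hM (by positivity)
      (pow_le_pow_of_le_one hh.le h1 (by norm_num))
    have k2 : M / h ≤ M / h ^ 3 := by
      have := div_le_div_of_nonneg_left hM (by positivity)
        (pow_le_pow_of_le_one hh.le h1 (by norm_num : 1 ≤ 3))
      simpa using this
    have e2 : 6 * M * Mi ^ 2 / h ^ 3 = 6 * (M / h ^ 3 * (Mi * Mi)) := by ring
    have hMM : 0 ≤ Mi * Mi := by positivity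
    have := mul_le_mul_of_nonneg_right k1 hMM
    have := mul_le_mul_of_nonneg_right k2 hMM
    rw [e2]
    linarith
  have hcellb : ∀ i, i + 1 ≤ n →
      |cell i| ≤ N ^ 3 * (6 * M * Mi ^ 2 / h ^ 3) * (1 / (c * n)) ^ 4 := by
    intro i hin
    have hm0 := hτ.mem i (by omega)
    have hm1 := hτ.mem (i + 1) hin
    have hle := hτ.mono hf (Nat.le_succ i) hin
    have hsub : Set.Icc (τ i) (τ (i + 1)) ⊆ Set.Icc 0 1 := Set.Icc_subset_Icc hm0.1 hm1.2
    have hsubo : Set.Ioo (τ i) (τ (i + 1)) ⊆ Set.Ioo 0 1 := Set.Ioo_subset_Ioo hm0.1 hm1.2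
    have hnb : ∀ s ∈ Set.Ioo (τ i) (τ (i + 1)), Set.Icc (0 : ℝ) 1 ∈ 𝓝 s := fun s hs =>
      Icc_mem_nhds (hsubo hs).1 (hsubo hs).2
    have hne : ∀ s ∈ Set.Ioo (τ i) (τ (i + 1)), f s ≠ 0 := fun s hs =>
      (hf.pos.trans_le (hf.lower s (hsub (Set.Ioo_subset_Icc_self hs)))).ne'
    have hinvc : ContinuousOn (fun s => (f s)⁻¹) (Set.Icc 0 1) :=
      fun s hs => (hi.deriv s hs).continuousWithinAt
    have := abs_trapezoid_cell_le (F := fun u => ∫ v in (0 : ℝ)..u, f v)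
      (Γ := fun u => ∫ v in (0 : ℝ)..u, G v * f v) (f := f) (G := G)
      (H := fun s => G1 s * (f s)⁻¹)
      (p := fun s => G2 s * ((f s)⁻¹ * (f s)⁻¹) + G1 s * (i1 s * (f s)⁻¹))
      (L := 6 * M * Mi ^ 2 / h ^ 3) hle (fun s hs => hf.abs_le (hsub hs)) (by positivity)
      ((continuousOn_integral_of_continuousOn_unit hf.cont).mono hsub)
      ((continuousOn_integral_of_continuousOn_unit hGf).mono hsub) (hGc.mono hsub)
      ((hG1c.mul hinvc).mono hsub)
      (fun s hs => hasDerivAt_integral_of_continuousOn_unit hf.cont (hsubo hs))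
      (fun s hs => hasDerivAt_integral_of_continuousOn_unit hGf (hsubo hs))
      (fun s hs => ((hG.deriv s (hsub (Set.Ioo_subset_Icc_self hs))).hasDerivAt
        (hnb s hs)).congr_deriv (by have := hne s hs; field_simp))
      (fun s hs => (((hG.deriv1 s (hsub (Set.Ioo_subset_Icc_self hs))).hasDerivAt
        (hnb s hs)).mul ((hi.deriv s (hsub (Set.Ioo_subset_Icc_self hs))).hasDerivAt
        (hnb s hs))).congr_deriv (by have := hne s hs; field_simp))
      (fun s hs => by
        have := hL s (hsub hs) (τ i) hm0
        rwa [abs_of_nonneg (sub_nonneg.2 hs.1)] at this)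
    rw [integral_sub_integral_unit hf.cont hm0 hm1, integral_sub_integral_unit hGf hm0 hm1,
      hτ.integral_eq hf (by omega) hin] at this
    have e : cell i = ((((i + 1 : ℕ) : ℝ) - i) / n) / 2 * (G (τ i) + G (τ (i + 1)))
        - (∫ v in (τ i)..(τ (i + 1)), G v * f v)
        - ((((i + 1 : ℕ) : ℝ) - i) / n) ^ 2 / 12
          * (G1 (τ (i + 1)) * (f (τ (i + 1)))⁻¹ - G1 (τ i) * (f (τ i))⁻¹) := by
      simp only [hcell]
      push_cast
      field_simp
      ring
    rw [e]
    refine this.trans (mul_le_mul_of_nonneg_left ?_ (by positivity))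
    exact pow_le_pow_left₀ (by linarith) (hτ.step_le hf hin) 4
  have hcell0 : ∀ i, i + 1 ≤ n → ¬ (τ i ≤ x + h ∧ x - h ≤ τ (i + 1)) → cell i = 0 := by
    intro i hin hnot
    have hle := hτ.mono hf (Nat.le_succ i) hin
    have hzero : ∀ s ∈ Set.Icc (τ i) (τ (i + 1)), G s = 0 ∧ G1 s = 0 := by
      intro s hs
      refine hz s ?_
      by_contra hlt
      rw [not_le, abs_lt] at hlt
      exact hnot ⟨by linarith [hs.1], by linarith [hs.2]⟩
    have hint_eq : ∫ s in (τ i)..(τ (i + 1)), G s * f s = 0 := by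
      rw [intervalIntegral.integral_congr (g := fun _ => 0)]
      · simp
      · intro s hs
        rw [Set.uIcc_of_le hle] at hs
        simp [(hzero s hs).1]
    simp [hcell, hint_eq, hzero (τ i) ⟨le_rfl, hle⟩, hzero (τ (i + 1)) ⟨hle, le_rfl⟩]
  rw [hsum]
  set S := (Finset.Ico p q).filter (fun i => τ i ≤ x + h ∧ x - h ≤ τ (i + 1)) with hSdef
  have hsum2 : ∑ i ∈ Finset.Ico p q, cell i = ∑ i ∈ S, cell i := by
    rw [hSdef, Finset.sum_filter]
    refine Finset.sum_congr rfl fun i hi => ?_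
    have := Finset.mem_Ico.1 hi
    split_ifs with hcond
    · rfl
    · exact hcell0 i (by omega) hcond
  have hcard : (S.card : ℝ) ≤ (2 * N + 2) * (n * h) := by
    refine hτ.card_le hf hh hnh hw fun i hi => ?_
    rw [hSdef, Finset.mem_filter, Finset.mem_Ico] at hi
    exact ⟨by omega, hi.2.1, Or.inr ⟨by omega, hi.2.2⟩⟩
  rw [hsum2]
  calc |∑ i ∈ S, cell i| ≤ ∑ i ∈ S, |cell i| := Finset.abs_sum_le_sum_abs _ _
    _ ≤ ∑ i ∈ S, N ^ 3 * (6 * M * Mi ^ 2 / h ^ 3) * (1 / (c * n)) ^ 4 := by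
        refine Finset.sum_le_sum fun i hi => hcellb i ?_
        rw [hSdef, Finset.mem_filter, Finset.mem_Ico] at hi
        omega
    _ = S.card * (N ^ 3 * (6 * M * Mi ^ 2 / h ^ 3) * (1 / (c * n)) ^ 4) := by simp
    _ ≤ ((2 * N + 2) * (n * h)) * (N ^ 3 * (6 * M * Mi ^ 2 / h ^ 3) * (1 / (c * n)) ^ 4) := by
        gcongr
    _ = _ := by field_simp

lemma integral_rescaled_kernel_eq (k w : ℝ → ℝ) {x h : ℝ} (hh : 0 < h) (a b : ℝ) :
    ∫ s in a..b, k ((x - s) / h) * w s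
      = h * ∫ z in ((x - b) / h)..((x - a) / h), k z * w (x - h * z) := by
  have := intervalIntegral.integral_comp_sub_div (a := a) (b := b)
    (fun z => k z * w (x - h * z)) hh.ne' (x / h)
  rw [smul_eq_mul] at this
  rw [sub_div, sub_div, ← this]
  refine intervalIntegral.integral_congr fun s _ => ?_
  have e : x - h * (x / h - s / h) = s := by field_simp; ring
  simp only [e, sub_div]

/-- The kernel `k` vanishes outside `(-1, 1)` and is twice differentiable with Lipschitz second
derivative. -/
structure IsSmoothKernel (Mk : ℝ) (k k1 k2 : ℝ → ℝ) : Prop where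
  nonneg : 0 ≤ Mk
  smooth : ScaledC2 Set.univ Mk 1 k k1 k2
  zero : ∀ s, 1 ≤ |s| → k s = 0 ∧ k1 s = 0 ∧ k2 s = 0

namespace IsSmoothKernel

variable {Mk x h : ℝ} {k k1 k2 w : ℝ → ℝ}

lemma continuous (hk : IsSmoothKernel Mk k k1 k2) : Continuous k :=
  continuous_iff_continuousAt.2 fun s =>
    (hasDerivWithinAt_univ.1 (hk.smooth.deriv s trivial)).continuousAt

lemma zero_of_le (hk : IsSmoothKernel Mk k k1 k2) (hh : 0 < h) {s : ℝ} (hs : h ≤ |x - s|) :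
    k ((x - s) / h) = 0 ∧ k1 ((x - s) / h) = 0 ∧ k2 ((x - s) / h) = 0 := by
  refine hk.zero _ ?_
  rw [abs_div, abs_of_pos hh, le_div_iff₀ hh]
  linarith

lemma continuousOn_mul (hk : IsSmoothKernel Mk k k1 k2) (hw : ContinuousOn w (Set.Icc 0 1)) :
    ContinuousOn (fun s => k ((x - s) / h) * w s) (Set.Icc 0 1) := by
  have := hk.continuous
  fun_prop

lemma integral_left (hk : IsSmoothKernel Mk k k1 k2) (hh : 0 < h)
    (hW : Set.Icc (x - h) (x + h) ⊆ Set.Icc (0 : ℝ) 1) (hw : ContinuousOn w (Set.Icc 0 1))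
    {a : ℝ} (ha : a ∈ Set.Icc (0 : ℝ) 1) :
    ∫ s in (0 : ℝ)..a, k ((x - s) / h) * w s
      = h * ∫ z in ((x - a) / h)..1, k z * w (x - h * z) := by
  have h0 := hW (Set.left_mem_Icc.2 (by linarith))
  have hc := hk.continuousOn_mul (x := x) (h := h) hw
  rw [← intervalIntegral.integral_add_adjacent_intervals
    (intervalIntegrable_of_continuousOn_unit hc ⟨le_rfl, zero_le_one⟩ h0)
    (intervalIntegrable_of_continuousOn_unit hc h0 ha), integral_rescaled_kernel_eq k w hh (x - h)]
  have e : (x - (x - h)) / h = 1 := by field_simp; ring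
  rw [e, intervalIntegral.integral_congr (g := fun _ => 0)]
  · simp
  · intro s hs
    rw [Set.uIcc_of_le h0.1] at hs
    simp only [(hk.zero_of_le (x := x) hh (s := s) (by
      rw [le_abs]; left; linarith [hs.2])).1, zero_mul]

lemma integral_right (hk : IsSmoothKernel Mk k k1 k2) (hh : 0 < h)
    (hW : Set.Icc (x - h) (x + h) ⊆ Set.Icc (0 : ℝ) 1) (hw : ContinuousOn w (Set.Icc 0 1))
    {a : ℝ} (ha : a ∈ Set.Icc (0 : ℝ) 1) :
    ∫ s in a..1, k ((x - s) / h) * w s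
      = h * ∫ z in (-1)..((x - a) / h), k z * w (x - h * z) := by
  have h0 := hW (Set.right_mem_Icc.2 (by linarith))
  have hc := hk.continuousOn_mul (x := x) (h := h) hw
  rw [← intervalIntegral.integral_add_adjacent_intervals
    (intervalIntegrable_of_continuousOn_unit hc ha h0)
    (intervalIntegrable_of_continuousOn_unit hc h0 ⟨zero_le_one, le_rfl⟩),
    integral_rescaled_kernel_eq k w hh a]
  have e : (x - (x + h)) / h = -1 := by field_simp; ring
  rw [e, intervalIntegral.integral_congr (a := x + h) (g := fun _ => 0)]
  · simp
  · intro s hs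
    rw [Set.uIcc_of_le h0.2] at hs
    simp only [(hk.zero_of_le (x := x) hh (s := s) (by
      rw [le_abs]; right; linarith [hs.1])).1, zero_mul]

lemma integral_full (hk : IsSmoothKernel Mk k k1 k2) (hh : 0 < h)
    (hW : Set.Icc (x - h) (x + h) ⊆ Set.Icc (0 : ℝ) 1) (hw : ContinuousOn w (Set.Icc 0 1)) :
    ∫ s in (0 : ℝ)..1, k ((x - s) / h) * w s = h * ∫ z in (-1)..1, k z * w (x - h * z) := by
  have h0 := hW (Set.right_mem_Icc.2 (by linarith))
  have hc := hk.continuousOn_mul (x := x) (h := h) hw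
  rw [← intervalIntegral.integral_add_adjacent_intervals
    (intervalIntegrable_of_continuousOn_unit hc ⟨le_rfl, zero_le_one⟩ h0)
    (intervalIntegrable_of_continuousOn_unit hc h0 ⟨zero_le_one, le_rfl⟩),
    hk.integral_left hh hW hw h0, hk.integral_right hh hW hw h0]
  have e : (x - (x + h)) / h = -1 := by field_simp; ring
  rw [e]
  simp

end IsSmoothKernel

/-- The weight `φ_{x,h}(τ_i) / (n f(τ_i))` of the grid point `τ i`. -/
noncomputable def kernelWeight (f k : ℝ → ℝ) (n : ℕ) (τ : ℕ → ℝ) (x h : ℝ) (i : ℕ) : ℝ :=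
  (1 / (n : ℝ)) * ((1 / h) * k ((x - τ i) / h) * (f (τ i))⁻¹)

/-- All the constraints relating the sample size, the bandwidth and the location. -/
structure Admissible (n : ℕ) (x h : ℝ) : Prop where
  pos : 0 < h
  le_one : h ≤ 1
  one_le : 1 ≤ (n : ℝ) * h
  window : Set.Icc (x - h) (x + h) ⊆ Set.Icc (0 : ℝ) 1

lemma Admissible.zero_le_abs {n : ℕ} {x h : ℝ} (ha : Admissible n x h) : h ≤ |x - 0| := by
  have := ha.window (Set.left_mem_Icc.2 (by linarith [ha.pos]))
  rw [le_abs]; left; linarith [this.1]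

lemma Admissible.one_le_abs {n : ℕ} {x h : ℝ} (ha : Admissible n x h) : h ≤ |x - 1| := by
  have := ha.window (Set.right_mem_Icc.2 (by linarith [ha.pos]))
  rw [le_abs]; right; linarith [this.2]

lemma sum_Ico_add_succ (a : ℕ → ℝ) {p q : ℕ} (hpq : p ≤ q) :
    ∑ j ∈ Finset.Ico p q, (a j + a (j + 1)) = 2 * (∑ j ∈ Finset.Ico p q, a j) + a q - a p := by
  induction q, hpq using Nat.le_induction with
  | base => simp
  | succ q hpq ih =>
    rw [Finset.sum_Ico_succ_top hpq, Finset.sum_Ico_succ_top hpq, ih]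
    ring

/-- The constant of the trapezoidal rule for products of a kernel, a smooth function and `1 / f`. -/
noncomputable def trapConst (c N Mi : ℝ) : ℝ :=
  ((2 * N + 2) * (N ^ 3 * (6 * Mi ^ 2)) / c ^ 4) * (64 * Mi)

section

variable {f i1 i2 : ℝ → ℝ} {τ : ℕ → ℝ} {n : ℕ} {c N Mi x h : ℝ}

lemma trapConst_nonneg (hf : BoundedDensity f c N) (hMi : 0 ≤ Mi) : 0 ≤ trapConst c N Mi := by
  have := hf.pos
  have := hf.nonneg
  unfold trapConst
  positivity

/-- Kernel-weighted grid sums approximate kernel-weighted integrals. -/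
theorem abs_sum_kernelWeight_mul_sub_le
    (hf : BoundedDensity f c N) (hi : ScaledC2 (Set.Icc 0 1) Mi 1 (fun s => (f s)⁻¹) i1 i2)
    (hMi : 0 ≤ Mi) (hτ : IsQuantileGrid f n τ) (ha : Admissible n x h)
    {Mk Mg : ℝ} {k k1 k2 g g1 g2 : ℝ → ℝ} (hk : IsSmoothKernel Mk k k1 k2)
    (hg : ScaledC2 (Set.Icc 0 1) Mg 1 g g1 g2) (hMg : 0 ≤ Mg) :
    |∑ i ∈ Finset.range (n + 1), kernelWeight f k n τ x h i * g (τ i)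
        - ∫ z in (-1)..1, k z * g (x - h * z)|
      ≤ trapConst c N Mi * Mk * Mg * (1 / (n * h)) ^ 3 := by
  have hh := ha.pos
  have hn : (0 : ℝ) < n := by exact_mod_cast hτ.pos
  have hMk := hk.nonneg
  have hS : (Set.Icc (0 : ℝ) 1).OrdConnected := Set.ordConnected_Icc
  have hG := (hk.smooth.comp_rescale x hh (Set.Icc 0 1)).mul
    ((hg.mul hi hS hMg hMi one_pos).mono_scale (by positivity) hh ha.le_one) hS hMk
    (by positivity) hh
  have key := abs_trapezoid_sum_le hf hi hMi hτ hh ha.le_one (by positivity) ha.one_le ha.window hG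
    (fun s hs => by
      have := hk.zero_of_le hh hs
      simp [this.1, this.2.1]) (Nat.zero_le n) le_rfl
  simp only [← Finset.mul_sum] at key
  rw [sum_Ico_add_succ (fun i => k ((x - τ i) / h) * (g (τ i) * (f (τ i))⁻¹)) (Nat.zero_le n),
    hτ.zero, hτ.last] at key
  have z0 := hk.zero_of_le hh ha.zero_le_abs
  simp only [sub_zero] at z0
  have z1 := hk.zero_of_le hh ha.one_le_abs
  have hgc : ContinuousOn g (Set.Icc 0 1) := fun s hs => (hg.deriv s hs).continuousWithinAt
  have hint_eq : ∫ s in (0 : ℝ)..1, k ((x - s) / h) * (g s * (f s)⁻¹) * f s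
      = h * ∫ z in (-1)..1, k z * g (x - h * z) := by
    rw [← hk.integral_full hh ha.window hgc]
    refine intervalIntegral.integral_congr fun s hs => ?_
    rw [Set.uIcc_of_le zero_le_one] at hs
    have : f s ≠ 0 := (hf.pos.trans_le (hf.lower s hs)).ne'
    field_simp
  rw [hint_eq] at key
  simp only [z0.1, z0.2.1, z1.1, z1.2.1, zero_mul, mul_zero, add_zero, sub_zero] at key
  have hs : ∑ i ∈ Finset.range (n + 1), kernelWeight f k n τ x h i * g (τ i)
      = (1 / h) * (1 / (2 * (n : ℝ)) *
        (2 * ∑ i ∈ Finset.Ico 0 n, k ((x - τ i) / h) * (g (τ i) * (f (τ i))⁻¹))) := by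
    rw [Finset.sum_range_succ, ← Finset.range_eq_Ico, Finset.mul_sum, Finset.mul_sum,
      Finset.mul_sum]
    unfold kernelWeight
    rw [hτ.last, z1.1]
    simp only [mul_zero, zero_mul, add_zero]
    refine Finset.sum_congr rfl fun i _ => ?_
    field_simp
  rw [hs]
  have e : ∀ A I : ℝ, (1 / h) * A - I = (1 / h) * (A - h * I) := fun A I => by field_simp
  rw [e, abs_mul, abs_of_pos (by positivity : 0 < 1 / h)]
  refine (mul_le_mul_of_nonneg_left key (one_div_nonneg.2 hh.le)).trans (le_of_eq ?_)
  unfold trapConst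
  field_simp
  ring

/-- Kernel-weighted grid sums of the distance to a grid point, with the correction due to the
kink. -/
theorem abs_sum_kernelWeight_mul_abs_sub_le
    (hf : BoundedDensity f c N) (hi : ScaledC2 (Set.Icc 0 1) Mi 1 (fun s => (f s)⁻¹) i1 i2)
    (hMi : 0 ≤ Mi) (hτ : IsQuantileGrid f n τ) (ha : Admissible n x h)
    {Mk : ℝ} {k k1 k2 : ℝ → ℝ} (hk : IsSmoothKernel Mk k k1 k2) {i : ℕ} (hin : i ≤ n) :
    |∑ j ∈ Finset.range (n + 1), kernelWeight f k n τ x h j * |τ i - τ j|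
        - h * ((∫ z in ((x - τ i) / h)..1, k z * (z - (x - τ i) / h))
          - ∫ z in (-1)..((x - τ i) / h), k z * (z - (x - τ i) / h))
        + 1 / (6 * (n : ℝ) ^ 2 * h) * (k ((x - τ i) / h) * (f (τ i))⁻¹ ^ 2)|
      ≤ 2 * trapConst c N Mi * Mk * (1 / (n * h)) ^ 3 := by
  have hh := ha.pos
  have hn : (0 : ℝ) < n := by exact_mod_cast hτ.pos
  have hMk := hk.nonneg
  have hS : (Set.Icc (0 : ℝ) 1).OrdConnected := Set.ordConnected_Icc
  have hti := hτ.mem i hin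
  have hlin : ScaledC2 (Set.Icc 0 1) 1 1 (fun s => τ i - s) (fun _ => -1) (fun _ => 0) := by
    refine ⟨fun s _ => ((hasDerivAt_id s).const_sub (τ i)).hasDerivWithinAt,
      fun s _ => hasDerivWithinAt_const _ _ _, fun s hs => ?_, by simp, by simp, by simp⟩
    rw [abs_le]
    constructor <;> linarith [hs.1, hs.2, hti.1, hti.2]
  have hG := (hk.smooth.comp_rescale x hh (Set.Icc 0 1)).mul
    ((hlin.mul hi hS zero_le_one hMi one_pos).mono_scale (by positivity) hh ha.le_one) hS hMk
    (by positivity) hh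
  have hz : ∀ s, h ≤ |x - s| → k ((x - s) / h) * ((τ i - s) * (f s)⁻¹) = 0 ∧
      -(1 / h) * k1 ((x - s) / h) * ((τ i - s) * (f s)⁻¹)
        + k ((x - s) / h) * (-1 * (f s)⁻¹ + (τ i - s) * i1 s) = 0 := fun s hs => by
      have := hk.zero_of_le hh hs
      simp [this.1, this.2.1]
  have key1 := abs_trapezoid_sum_le hf hi hMi hτ hh ha.le_one (by positivity) ha.one_le ha.window hG
    hz (Nat.zero_le i) hin
  have key2 := abs_trapezoid_sum_le hf hi hMi hτ hh ha.le_one (by positivity) ha.one_le ha.window hG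
    hz hin le_rfl
  simp only [← Finset.mul_sum] at key1 key2
  rw [sum_Ico_add_succ (fun j => k ((x - τ j) / h) * ((τ i - τ j) * (f (τ j))⁻¹)) (Nat.zero_le i),
    hτ.zero] at key1
  rw [sum_Ico_add_succ (fun j => k ((x - τ j) / h) * ((τ i - τ j) * (f (τ j))⁻¹)) hin,
    hτ.last] at key2
  have z0 := hk.zero_of_le hh ha.zero_le_abs
  simp only [sub_zero] at z0
  have z1 := hk.zero_of_le hh ha.one_le_abs
  have hpull : ∀ a ∈ Set.Icc (0 : ℝ) 1, ∀ b ∈ Set.Icc (0 : ℝ) 1,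
      ∫ s in a..b, k ((x - s) / h) * ((τ i - s) * (f s)⁻¹) * f s
        = ∫ s in a..b, k ((x - s) / h) * (τ i - s) := by
    intro a ha b hb
    refine intervalIntegral.integral_congr fun s hs => ?_
    have : f s ≠ 0 := (hf.pos.trans_le (hf.lower s (Set.uIcc_subset_Icc ha hb hs))).ne'
    field_simp
  have hpoint : ∀ z, k z * (τ i - (x - h * z)) = h * (k z * (z - (x - τ i) / h)) := fun z => by
    field_simp
    ring
  rw [hpull 0 ⟨le_rfl, zero_le_one⟩ _ hti, hk.integral_left hh ha.window (by fun_prop) hti] at key1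
  rw [hpull _ hti 1 ⟨zero_le_one, le_rfl⟩, hk.integral_right hh ha.window (by fun_prop) hti] at key2
  simp only [hpoint, intervalIntegral.integral_const_mul] at key1 key2
  simp only [z0.1, z0.2.1, z1.1, z1.2.1, zero_mul, mul_zero, add_zero, sub_zero, sub_self,
    zero_add] at key1 key2
  set I1 := ∫ z in ((x - τ i) / h)..1, k z * (z - (x - τ i) / h)
  set I2 := ∫ z in (-1)..((x - τ i) / h), k z * (z - (x - τ i) / h)
  set S1 := ∑ j ∈ Finset.Ico 0 i, k ((x - τ j) / h) * ((τ i - τ j) * (f (τ j))⁻¹)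
  set S2 := ∑ j ∈ Finset.Ico i n, k ((x - τ j) / h) * ((τ i - τ j) * (f (τ j))⁻¹)
  have hs : ∑ j ∈ Finset.range (n + 1), kernelWeight f k n τ x h j * |τ i - τ j|
      = (1 / h) * (1 / (2 * (n : ℝ)) * (2 * S1)) - (1 / h) * (1 / (2 * (n : ℝ)) * (2 * S2)) := by
    rw [Finset.sum_range_succ, Finset.range_eq_Ico,
      ← Finset.sum_Ico_consecutive _ (Nat.zero_le i) hin, Finset.mul_sum, Finset.mul_sum,
      Finset.mul_sum, Finset.mul_sum, Finset.mul_sum, Finset.mul_sum]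
    have hlast : kernelWeight f k n τ x h n = 0 := by
      unfold kernelWeight
      rw [hτ.last, z1.1]
      simp
    rw [hlast, zero_mul, add_zero, sub_eq_add_neg, ← Finset.sum_neg_distrib]
    congr 1
    · refine Finset.sum_congr rfl fun j hj => ?_
      have hj := Finset.mem_Ico.1 hj
      rw [abs_of_nonneg (sub_nonneg.2 (hτ.mono hf hj.2.le hin))]
      unfold kernelWeight
      field_simp
    · refine Finset.sum_congr rfl fun j hj => ?_
      have hj := Finset.mem_Ico.1 hj
      rw [abs_of_nonpos (sub_nonpos.2 (hτ.mono hf hj.1 hj.2.le))]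
      unfold kernelWeight
      field_simp
  rw [hs]
  have e : (1 / h) * (1 / (2 * (n : ℝ)) * (2 * S1)) - (1 / h) * (1 / (2 * (n : ℝ)) * (2 * S2))
      - h * (I1 - I2) + 1 / (6 * (n : ℝ) ^ 2 * h) * (k ((x - τ i) / h) * (f (τ i))⁻¹ ^ 2)
      = (1 / h) * ((1 / (2 * (n : ℝ)) * (2 * S1) - h * (h * I1)
            - 1 / (12 * (n : ℝ) ^ 2) * (k ((x - τ i) / h) * (-1 * (f (τ i))⁻¹) * (f (τ i))⁻¹))
          - (1 / (2 * (n : ℝ)) * (2 * S2) - h * (h * I2)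
            - 1 / (12 * (n : ℝ) ^ 2)
              * (0 - k ((x - τ i) / h) * (-1 * (f (τ i))⁻¹) * (f (τ i))⁻¹))) := by
    field_simp
    ring
  rw [zero_sub] at e
  simp only [zero_sub] at key2
  rw [e, abs_mul, abs_of_pos (by positivity : 0 < 1 / h)]
  refine (mul_le_mul_of_nonneg_left ((abs_sub _ _).trans (add_le_add key1 key2))
    (one_div_nonneg.2 hh.le)).trans (le_of_eq ?_)
  unfold trapConst
  field_simp
  ring

end

lemma eq_zero_of_one_le_abs_of_continuous {w : ℝ → ℝ} (hw : Continuous w)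
    (hz : ∀ s, 1 < |s| → w s = 0) {s : ℝ} (hs : 1 ≤ |s|) : w s = 0 := by
  have h1 : Tendsto (fun r => w (r * s)) (𝓝[>] 1) (𝓝 (w (1 * s))) :=
    (Continuous.tendsto (by fun_prop) 1).mono_left nhdsWithin_le_nhds
  have h2 : Tendsto (fun r => w (r * s)) (𝓝[>] 1) (𝓝 0) := by
    refine tendsto_const_nhds.congr' ?_
    filter_upwards [self_mem_nhdsWithin] with r hr
    refine (hz _ ?_).symm
    have hr : 1 < r := hr
    rw [abs_mul, abs_of_pos (by linarith : 0 < r)]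
    nlinarith
  simpa using tendsto_nhds_unique h1 h2

lemma hasDerivAt_eq_zero_of_one_lt_abs {w w1 : ℝ → ℝ} (hd : ∀ s, HasDerivAt w (w1 s) s)
    (hz : ∀ s, 1 < |s| → w s = 0) {s : ℝ} (hs : 1 < |s|) : w1 s = 0 := by
  have he : w =ᶠ[𝓝 s] fun _ => 0 := by
    filter_upwards [continuous_abs.continuousAt.eventually (lt_mem_nhds hs)] with r hr
    exact hz r hr
  exact ((hd s).congr_of_eventuallyEq he.symm).unique (hasDerivAt_const s 0)

lemma exists_isSmoothKernel_of_contDiff {K : ℝ → ℝ}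
    (hsupp : ∀ u : ℝ, u ∉ Set.Icc (-1 : ℝ) 1 → K u = 0) (hK : ContDiff ℝ 2 K)
    (hlip : ∃ L : NNReal, LipschitzOnWith L (iteratedDeriv 2 K) (Set.Icc (-1 : ℝ) 1)) :
    ∃ Mk, IsSmoothKernel Mk K (deriv K) (iteratedDeriv 2 K) := by
  obtain ⟨L, hL⟩ := hlip
  have h1 : ContDiff ℝ 1 (deriv K) := by
    have : ContDiff ℝ (1 + 1) K := by norm_num; exact hK
    exact (contDiff_succ_iff_deriv.1 this).2.2
  have hd : ∀ s, HasDerivAt K (deriv K s) s := fun s =>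
    (hK.differentiable (by norm_num) s).hasDerivAt
  have hd1 : ∀ s, HasDerivAt (deriv K) (iteratedDeriv 2 K s) s := fun s => by
    rw [iteratedDeriv_succ, iteratedDeriv_one]
    exact (h1.differentiable (by norm_num) s).hasDerivAt
  have z0 : ∀ s, 1 < |s| → K s = 0 := fun s hs =>
    hsupp s fun h => (abs_le.2 h).not_gt hs
  have z1 : ∀ s, 1 < |s| → deriv K s = 0 := fun s hs => hasDerivAt_eq_zero_of_one_lt_abs hd z0 hs
  have z2 : ∀ s, 1 < |s| → iteratedDeriv 2 K s = 0 := fun s hs =>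
    hasDerivAt_eq_zero_of_one_lt_abs hd1 z1 hs
  have hz : ∀ s, 1 ≤ |s| → K s = 0 ∧ deriv K s = 0 ∧ iteratedDeriv 2 K s = 0 := fun s hs =>
    ⟨eq_zero_of_one_le_abs_of_continuous hK.continuous z0 hs,
      eq_zero_of_one_le_abs_of_continuous h1.continuous z1 hs,
      eq_zero_of_one_le_abs_of_continuous (hK.continuous_iteratedDeriv 2 le_rfl) z2 hs⟩
  obtain ⟨M, hM, h⟩ := ScaledC2.exists_univ_of_lipschitz (L := L) hd hd1 hz fun s hs u hu => by
    simpa [Real.dist_eq] using hL.dist_le_mul s hs u hu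
  exact ⟨M, hM, h, hz⟩

namespace IsSmoothKernel

variable {Mk : ℝ} {k k1 k2 : ℝ → ℝ}

lemma hasDerivAt (hk : IsSmoothKernel Mk k k1 k2) (s : ℝ) : HasDerivAt k (k1 s) s :=
  hasDerivWithinAt_univ.1 (hk.smooth.deriv s trivial)

lemma hasDerivAt1 (hk : IsSmoothKernel Mk k k1 k2) (s : ℝ) : HasDerivAt k1 (k2 s) s :=
  hasDerivWithinAt_univ.1 (hk.smooth.deriv1 s trivial)

lemma abs_le (hk : IsSmoothKernel Mk k k1 k2) (s : ℝ) : |k s| ≤ Mk := hk.smooth.bound s trivial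

/-- The kernel vanishes to third order at the boundary of its support. -/
lemma abs_le_cube (hk : IsSmoothKernel Mk k k1 k2) {e d s : ℝ} (he : 1 ≤ |e|) (hs : |s - e| ≤ d) :
    |k s| ≤ Mk * d ^ 3 := by
  have hM := hk.nonneg
  have hd : 0 ≤ d := (abs_nonneg _).trans hs
  obtain ⟨z0, z1, z2⟩ := hk.zero e he
  have hS : (Set.Icc (e - d) (e + d)).OrdConnected := Set.ordConnected_Icc
  have hmem : ∀ {u}, u ∈ Set.Icc (e - d) (e + d) → |u - e| ≤ d := fun {u} hu =>
    _root_.abs_le.2 ⟨by linarith [hu.1], by linarith [hu.2]⟩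
  have heS : e ∈ Set.Icc (e - d) (e + d) := ⟨by linarith, by linarith⟩
  have b2 : ∀ u ∈ Set.Icc (e - d) (e + d), |k2 u| ≤ Mk * d := fun u hu => by
    have := hk.smooth.lip2 u trivial e trivial
    rw [z2, sub_zero] at this
    refine this.trans ?_
    have := mul_le_mul_of_nonneg_left (hmem hu) hM
    norm_num
    exact this
  have b1 : ∀ u ∈ Set.Icc (e - d) (e + d), |k1 u| ≤ Mk * d * d := fun u hu => by
    have := abs_sub_le_of_abs_hasDerivWithinAt_le hS
      (fun s _ => (hk.hasDerivAt1 s).hasDerivWithinAt) b2 hu heS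
    rw [z1, sub_zero] at this
    exact this.trans (mul_le_mul_of_nonneg_left (hmem hu) (by positivity))
  have hsS : s ∈ Set.Icc (e - d) (e + d) := by
    have := _root_.abs_le.1 hs
    exact ⟨by linarith, by linarith⟩
  have := abs_sub_le_of_abs_hasDerivWithinAt_le hS
      (fun s _ => (hk.hasDerivAt s).hasDerivWithinAt) b1 hsS heS
  rw [z0, sub_zero] at this
  refine this.trans ((mul_le_mul_of_nonneg_left hs (by positivity)).trans_eq ?_)
  ring

/-- The product of a kernel and a smooth function is a kernel. -/
lemma exists_mul (hk : IsSmoothKernel Mk k k1 k2) {w w1 w2 : ℝ → ℝ} {L : ℝ}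
    (hd : ∀ s, HasDerivAt w (w1 s) s) (hd1 : ∀ s, HasDerivAt w1 (w2 s) s)
    (hL : ∀ s ∈ Set.Icc (-1 : ℝ) 1, ∀ u ∈ Set.Icc (-1 : ℝ) 1, |w2 s - w2 u| ≤ L * |s - u|) :
    ∃ M p1 p2, IsSmoothKernel M (fun s => k s * w s) p1 p2 := by
  have hz : ∀ s, 1 ≤ |s| → k s * w s = 0 ∧ k1 s * w s + k s * w1 s = 0 ∧
      k2 s * w s + 2 * (k1 s * w1 s) + k s * w2 s = 0 := fun s hs => by
    obtain ⟨z0, z1, z2⟩ := hk.zero s hs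
    simp [z0, z1, z2]
  obtain ⟨Mw, hMw, hw⟩ := ScaledC2.exists_of_lipschitz (fun s _ => (hd s).hasDerivWithinAt)
    (fun s _ => (hd1 s).hasDerivWithinAt) hL
  obtain ⟨M', hM', hk'⟩ := ScaledC2.exists_of_lipschitz (a := -1) (b := 1) (L := Mk)
    (fun s _ => (hk.hasDerivAt s).hasDerivWithinAt)
    (fun s _ => (hk.hasDerivAt1 s).hasDerivWithinAt)
    (fun s _ u _ => by simpa using hk.smooth.lip2 s trivial u trivial)
  have hmul := hk'.mul hw Set.ordConnected_Icc hM' hMw one_pos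
  obtain ⟨M, hM, h⟩ := ScaledC2.exists_univ_of_lipschitz
    (fun s => (hk.hasDerivAt s).mul (hd s))
    (fun s => (((hk.hasDerivAt1 s).mul (hd s)).add
      ((hk.hasDerivAt s).mul (hd1 s))).congr_deriv (by ring :
        _ = k2 s * w s + 2 * (k1 s * w1 s) + k s * w2 s)) hz hmul.lip2
  exact ⟨M, _, _, hM, h, hz⟩

lemma exists_sq (hk : IsSmoothKernel Mk k k1 k2) :
    ∃ M p1 p2, IsSmoothKernel M (fun s => k s ^ 2) p1 p2 := by
  simp only [sq]
  exact hk.exists_mul hk.hasDerivAt hk.hasDerivAt1 (L := Mk)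
    (fun s _ u _ => by simpa using hk.smooth.lip2 s trivial u trivial)

end IsSmoothKernel

/-- The mean signed distance `∫_y^1 (z - y) k(z) dz - ∫_{-1}^y (z - y) k(z) dz` of `y` to the
kernel `k`. -/
noncomputable def kernelDist (k : ℝ → ℝ) (y : ℝ) : ℝ :=
  (∫ z in y..1, k z * (z - y)) - ∫ z in (-1)..y, k z * (z - y)

lemma kernelDist_eq {k : ℝ → ℝ} (hk : Continuous k) (hint_eq : ∫ z in (-1)..1, k z = 1) (y : ℝ) :
    kernelDist k y = 2 * (y * (∫ z in (-1)..y, k z) - ∫ z in (-1)..y, k z * z) - y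
      + ∫ z in (-1)..1, k z * z := by
  have hi : ∀ a b, IntervalIntegrable k volume a b := fun a b => hk.intervalIntegrable a b
  have hi' : ∀ a b, IntervalIntegrable (fun z => k z * z) volume a b := fun a b =>
    Continuous.intervalIntegrable (by fun_prop) a b
  have e : ∀ a b, ∫ z in a..b, k z * (z - y) = (∫ z in a..b, k z * z) - (∫ z in a..b, k z) * y := by
    intro a b
    simp only [mul_sub]
    rw [intervalIntegral.integral_sub (hi' a b)
      (Continuous.intervalIntegrable (by fun_prop) a b), intervalIntegral.integral_mul_const]
  have a1 := intervalIntegral.integral_add_adjacent_intervals (hi (-1) y) (hi y 1)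
  have a2 := intervalIntegral.integral_add_adjacent_intervals (hi' (-1) y) (hi' y 1)
  rw [kernelDist, e, e, ← a2]
  rw [hint_eq] at a1
  linear_combination -y * a1

lemma kernelDist_eq_integral_abs {k : ℝ → ℝ} (hk : Continuous k) {y : ℝ}
    (hy : y ∈ Set.Icc (-1 : ℝ) 1) : kernelDist k y = ∫ v in (-1)..1, |y - v| * k v := by
  rw [← intervalIntegral.integral_add_adjacent_intervals
    (Continuous.intervalIntegrable (by fun_prop) (-1) y)
    (Continuous.intervalIntegrable (by fun_prop) y 1), kernelDist, sub_eq_add_neg, add_comm,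
    ← intervalIntegral.integral_neg]
  congr 1
  · refine intervalIntegral.integral_congr fun v hv => ?_
    rw [Set.uIcc_of_le hy.1] at hv
    simp only [abs_of_nonneg (sub_nonneg.2 hv.2)]
    ring
  · refine intervalIntegral.integral_congr fun v hv => ?_
    rw [Set.uIcc_of_le hy.2] at hv
    simp only [abs_of_nonpos (sub_nonpos.2 hv.1)]
    ring

namespace IsSmoothKernel

variable {Mk : ℝ} {k k1 k2 : ℝ → ℝ}

lemma exists_mul_kernelDist (hk : IsSmoothKernel Mk k k1 k2) (hint_eq : ∫ z in (-1)..1, k z = 1) :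
    ∃ M p1 p2, IsSmoothKernel M (fun s => k s * kernelDist k s) p1 p2 := by
  have hc := hk.continuous
  have hc' : Continuous fun z => k z * z := by fun_prop
  have dP : ∀ y, HasDerivAt (fun y => ∫ z in (-1)..y, k z) (k y) y := fun y =>
    hc.integral_hasStrictDerivAt (-1) y |>.hasDerivAt
  have dZ : ∀ y, HasDerivAt (fun y => ∫ z in (-1)..y, k z * z) (k y * y) y := fun y =>
    hc'.integral_hasStrictDerivAt (-1) y |>.hasDerivAt
  have hd : ∀ y, HasDerivAt (kernelDist k) (2 * (∫ z in (-1)..y, k z) - 1) y := fun y => by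
    have := ((((((hasDerivAt_id y).mul (dP y)).sub (dZ y)).const_mul 2).sub
      (hasDerivAt_id y)).add_const (∫ z in (-1)..1, k z * z))
    have he : kernelDist k = fun y => 2 * (y * (∫ z in (-1)..y, k z) - ∫ z in (-1)..y, k z * z) - y
        + ∫ z in (-1)..1, k z * z := funext (kernelDist_eq hc hint_eq)
    rw [he]
    refine this.congr_deriv ?_
    simp only [id]
    ring
  refine hk.exists_mul hd (fun y => ((dP y).const_mul 2).sub_const 1) (L := 2 * Mk) ?_
  intro s _ u _
  rw [← mul_sub, abs_mul, abs_two, mul_assoc]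
  have := hk.smooth.lip0 Set.ordConnected_univ (s := s) (u := u) trivial trivial
  rw [div_one] at this
  linarith

end IsSmoothKernel

/-- The grid `0, t_{1,n}, …, t_{n,n}` of design points completed by the left endpoint. -/
def designGrid (t : ℕ → ℕ → ℝ) (n i : ℕ) : ℝ := if i = 0 then 0 else t n i

lemma designGrid_of_pos (t : ℕ → ℕ → ℝ) (n : ℕ) {i : ℕ} (hi : 1 ≤ i) :
    designGrid t n i = t n i := if_neg (by omega)

lemma isQuantileGrid_designGrid {f : ℝ → ℝ} {c N : ℝ} (hf : BoundedDensity f c N)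
    (hf1 : ∫ s in (0:ℝ)..1, f s = 1) {t : ℕ → ℕ → ℝ}
    (hmem : ∀ n i : ℕ, 1 ≤ i → i ≤ n → t n i ∈ Set.Icc (0:ℝ) 1)
    (hdef : ∀ n i : ℕ, 1 ≤ i → i ≤ n → ∫ s in (0:ℝ)..(t n i), f s = (i : ℝ) / n)
    {n : ℕ} (hn : 1 ≤ n) : IsQuantileGrid f n (designGrid t n) where
  pos := hn
  zero := if_pos rfl
  last := by
    rw [designGrid_of_pos t n hn]
    have hm := hmem n n hn le_rfl
    have h1 : (1 : ℝ) ∈ Set.Icc (0 : ℝ) 1 := ⟨zero_le_one, le_rfl⟩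
    have h := hf.le_integral hm h1 hm.2
    rw [← integral_sub_integral_unit hf.cont hm h1, hf1, hdef n n hn le_rfl,
      div_self (by positivity), sub_self] at h
    have := hf.pos
    nlinarith [hm.2]
  mem i hi := by
    rcases Nat.eq_zero_or_pos i with rfl | h
    · simp [designGrid]
    · rw [designGrid_of_pos t n h]
      exact hmem n i h hi
  cdf i hi := by
    rcases Nat.eq_zero_or_pos i with rfl | h
    · simp [designGrid]
    · rw [designGrid_of_pos t n h]
      exact hdef n i h hi

/-- Half the number of cells `[i, i + 1]`, `i ∈ I`, having `j` as an endpoint. -/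
noncomputable def trapCoef (I : Finset ℕ) (j : ℕ) : ℝ :=
  ((if j ∈ I then 1 else 0) + (if 1 ≤ j ∧ j - 1 ∈ I then 1 else 0)) / 2

lemma trapCoef_mem_Icc (I : Finset ℕ) (j : ℕ) : trapCoef I j ∈ Set.Icc (0 : ℝ) 1 := by
  unfold trapCoef
  split_ifs <;> norm_num

lemma sum_add_succ_eq_sum_trapCoef {I : Finset ℕ} {n : ℕ} (hI : I ⊆ Finset.range n) (G : ℕ → ℝ) :
    ∑ i ∈ I, (G i + G (i + 1)) = 2 * ∑ j ∈ Finset.range (n + 1), trapCoef I j * G j := by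
  have e1 : ∑ i ∈ I, G i = ∑ j ∈ Finset.range (n + 1), if j ∈ I then G j else 0 := by
    rw [← Finset.sum_filter, Finset.filter_mem_eq_inter,
      Finset.inter_eq_right.2 (hI.trans (Finset.range_mono (Nat.le_succ n)))]
  have e2 : ∑ i ∈ I, G (i + 1)
      = ∑ j ∈ Finset.range (n + 1), if 1 ≤ j ∧ j - 1 ∈ I then G j else 0 := by
    rw [Finset.sum_range_succ']
    simp only [Nat.add_sub_cancel, le_add_iff_nonneg_left, zero_le, true_and]
    rw [← Finset.sum_filter, Finset.filter_mem_eq_inter, Finset.inter_eq_right.2 hI]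
    simp
  rw [Finset.sum_add_distrib, e1, e2, ← Finset.sum_add_distrib, Finset.mul_sum]
  refine Finset.sum_congr rfl fun j _ => ?_
  unfold trapCoef
  split_ifs <;> ring

lemma trapIdx_subset_range (t : ℕ → ℕ → ℝ) (n : ℕ) (x h : ℝ) :
    trapIdx t n x h ⊆ Finset.range n := fun i hi => by
  have := Finset.mem_Icc.1 (Finset.mem_filter.1 hi).1
  exact Finset.mem_range.2 (by omega)

lemma one_le_of_mem_trapIdx {t : ℕ → ℕ → ℝ} {n i : ℕ} {x h : ℝ} (hi : i ∈ trapIdx t n x h) :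
    1 ≤ i := (Finset.mem_Icc.1 (Finset.mem_filter.1 hi).1).1

lemma mem_trapIdx_iff {t : ℕ → ℕ → ℝ} {n i : ℕ} {x h : ℝ} (h1 : 1 ≤ i) (hn : i + 1 ≤ n) :
    i ∈ trapIdx t n x h ↔ designGrid t n i ∈ Set.Icc (x - h) (x + h) ∧
      designGrid t n (i + 1) ∈ Set.Icc (x - h) (x + h) := by
  rw [designGrid_of_pos t n h1, designGrid_of_pos t n (Nat.le_add_left 1 i), trapIdx,
    Finset.mem_filter, Finset.mem_Icc]
  exact and_iff_right ⟨h1, by omega⟩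

/-- The weight of the design point `t_{j,n}` in the trapezoidal estimator. -/
noncomputable def trapWeight (K f : ℝ → ℝ) (t : ℕ → ℕ → ℝ) (n : ℕ) (x h : ℝ) (j : ℕ) : ℝ :=
  trapCoef (trapIdx t n x h) j * kernelWeight f K n (designGrid t n) x h j

lemma trapSum_eq_sum_trapWeight (K f g : ℝ → ℝ) (t : ℕ → ℕ → ℝ) (n : ℕ) (x h : ℝ) :
    trapSum t n x h (fun s => phiK K x h s * g s / f s)
      = ∑ j ∈ Finset.range (n + 1), trapWeight K f t n x h j * g (designGrid t n j) := by
  have e : ∑ i ∈ trapIdx t n x h, (phiK K x h (t n i) * g (t n i) / f (t n i)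
        + phiK K x h (t n (i + 1)) * g (t n (i + 1)) / f (t n (i + 1)))
      = ∑ i ∈ trapIdx t n x h, ((fun j => phiK K x h (designGrid t n j) * g (designGrid t n j)
          / f (designGrid t n j)) i + (fun j => phiK K x h (designGrid t n j)
            * g (designGrid t n j) / f (designGrid t n j)) (i + 1)) := by
    refine Finset.sum_congr rfl fun i hi => ?_
    simp only [designGrid_of_pos t n (one_le_of_mem_trapIdx hi),
      designGrid_of_pos t n (Nat.le_add_left 1 i)]
  rw [trapSum, e, sum_add_succ_eq_sum_trapCoef (trapIdx_subset_range t n x h), ← mul_assoc,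
    Finset.mul_sum]
  refine Finset.sum_congr rfl fun j _ => ?_
  unfold trapWeight kernelWeight phiK
  ring

lemma Qform_eq_sum_trapWeight (K f : ℝ → ℝ) (R : ℝ → ℝ → ℝ) (t : ℕ → ℕ → ℝ) (n : ℕ) (x h : ℝ) :
    Qform K f R t n x h = ∑ i ∈ Finset.range (n + 1), ∑ j ∈ Finset.range (n + 1),
      trapWeight K f t n x h i * trapWeight K f t n x h j
        * R (designGrid t n i) (designGrid t n j) := by
  set Ψ : ℕ → ℕ → ℝ := fun i j => PhiR K f R x h (designGrid t n i) (designGrid t n j)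
  have e : ∑ i ∈ trapIdx t n x h, ∑ j ∈ trapIdx t n x h,
      (PhiR K f R x h (t n i) (t n j) + PhiR K f R x h (t n i) (t n (j + 1))
        + PhiR K f R x h (t n (i + 1)) (t n j) + PhiR K f R x h (t n (i + 1)) (t n (j + 1)))
      = ∑ i ∈ trapIdx t n x h, ((fun i => ∑ j ∈ trapIdx t n x h, (Ψ i j + Ψ i (j + 1))) i
        + (fun i => ∑ j ∈ trapIdx t n x h, (Ψ i j + Ψ i (j + 1))) (i + 1)) := by
    refine Finset.sum_congr rfl fun i hi => ?_
    simp only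
    rw [← Finset.sum_add_distrib]
    refine Finset.sum_congr rfl fun j hj => ?_
    simp only [Ψ, designGrid_of_pos t n (one_le_of_mem_trapIdx hi),
      designGrid_of_pos t n (one_le_of_mem_trapIdx hj),
      designGrid_of_pos t n (Nat.le_add_left 1 _)]
    ring
  rw [Qform, e, sum_add_succ_eq_sum_trapCoef (trapIdx_subset_range t n x h), ← mul_assoc,
    Finset.mul_sum]
  refine Finset.sum_congr rfl fun i _ => ?_
  rw [sum_add_succ_eq_sum_trapCoef (trapIdx_subset_range t n x h), Finset.mul_sum, Finset.mul_sum,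
    Finset.mul_sum]
  refine Finset.sum_congr rfl fun j _ => ?_
  simp only [Ψ]
  unfold trapWeight kernelWeight PhiR phiK
  ring

section

variable {f k k1 k2 : ℝ → ℝ} {τ : ℕ → ℝ} {n : ℕ} {c N Mi Mk x h B : ℝ}

lemma BoundedDensity.abs_inv_le (hf : BoundedDensity f c N) {s : ℝ} (hs : s ∈ Set.Icc (0 : ℝ) 1) :
    |(f s)⁻¹| ≤ c⁻¹ := by
  have := hf.lower s hs
  have hc := hf.pos
  rw [abs_of_pos (inv_pos.2 (hc.trans_le this))]
  exact inv_anti₀ hc this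

lemma IsQuantileGrid.sum_abs_le (hτ : IsQuantileGrid f n τ) (hf : BoundedDensity f c N)
    (ha : Admissible n x h) {F : ℕ → ℝ} (hB : 0 ≤ B) (hF : ∀ j ≤ n, |F j| ≤ B)
    (hF0 : ∀ j ≤ n, h ≤ |x - τ j| → F j = 0) :
    ∑ j ∈ Finset.range (n + 1), |F j| ≤ (2 * N + 2) * (n * h) * B := by
  have hS := hτ.card_le hf ha.pos ha.one_le ha.window
    (S := (Finset.range (n + 1)).filter fun j => |x - τ j| < h) (fun i hi => by
      obtain ⟨h1, h2⟩ := Finset.mem_filter.1 hi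
      have h3 := abs_lt.1 h2
      exact ⟨by simpa [Nat.lt_succ_iff] using h1, by linarith [h3.1], Or.inl (by linarith [h3.2])⟩)
  have e : ∑ j ∈ Finset.range (n + 1), |F j|
      = ∑ j ∈ (Finset.range (n + 1)).filter (fun j => |x - τ j| < h), |F j| := by
    rw [Finset.sum_filter]
    refine Finset.sum_congr rfl fun j hj => ?_
    split_ifs with hlt
    · rfl
    · rw [hF0 j (Nat.lt_succ_iff.1 (Finset.mem_range.1 hj)) (not_lt.1 hlt), abs_zero]
  rw [e]
  refine (Finset.sum_le_card_nsmul _ _ B fun j hj => hF j ?_).trans ?_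
  · exact Nat.lt_succ_iff.1 (Finset.mem_range.1 (Finset.mem_filter.1 hj).1)
  · rw [nsmul_eq_mul]
    exact mul_le_mul_of_nonneg_right hS hB

lemma IsSmoothKernel.kernelWeight_eq_zero (hk : IsSmoothKernel Mk k k1 k2) (hh : 0 < h) {j : ℕ}
    (hj : h ≤ |x - τ j|) : kernelWeight f k n τ x h j = 0 := by
  unfold kernelWeight
  rw [(hk.zero_of_le hh hj).1]
  ring

lemma abs_kernelWeight_le (hf : BoundedDensity f c N) (hτ : IsQuantileGrid f n τ) (hh : 0 < h)
    {j : ℕ} (hj : j ≤ n) (hB : |k ((x - τ j) / h)| ≤ B) :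
    |kernelWeight f k n τ x h j| ≤ 1 / (n * h) * (B * c⁻¹) := by
  have e : kernelWeight f k n τ x h j = 1 / (n * h) * (k ((x - τ j) / h) * (f (τ j))⁻¹) := by
    unfold kernelWeight
    rw [one_div_mul_eq_div, one_div_mul_eq_div, one_div_mul_eq_div]
    ring
  rw [e, abs_mul, abs_mul, abs_of_nonneg (by positivity : 0 ≤ 1 / (n * h))]
  refine mul_le_mul_of_nonneg_left ?_ (by positivity)
  exact mul_le_mul hB (hf.abs_inv_le (hτ.mem j hj)) (abs_nonneg _) ((abs_nonneg _).trans hB)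

lemma sum_abs_kernelWeight_le (hf : BoundedDensity f c N) (hτ : IsQuantileGrid f n τ)
    (ha : Admissible n x h) (hk : IsSmoothKernel Mk k k1 k2) :
    ∑ j ∈ Finset.range (n + 1), |kernelWeight f k n τ x h j| ≤ (2 * N + 2) * (Mk * c⁻¹) := by
  have hh := ha.pos
  have hn : (0 : ℝ) < n := by exact_mod_cast hτ.pos
  have := hf.pos
  have := hk.nonneg
  refine (hτ.sum_abs_le hf ha (by positivity)
    (fun j hj => abs_kernelWeight_le hf hτ hh hj (hk.abs_le _))
    fun j _ h => hk.kernelWeight_eq_zero hh h).trans_eq ?_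
  field_simp

/-- The trapezoidal weights differ from the kernel weights only next to the edge of the window. -/
lemma sum_abs_trapWeight_sub_kernelWeight_le {t : ℕ → ℕ → ℝ} (hf : BoundedDensity f c N)
    (hτ : IsQuantileGrid f n (designGrid t n)) (ha : Admissible n x h)
    (hk : IsSmoothKernel Mk k k1 k2) :
    ∑ j ∈ Finset.range (n + 1),
        |trapWeight k f t n x h j - kernelWeight f k n (designGrid t n) x h j|
      ≤ (2 * N + 2) * (Mk * c⁻¹ ^ 4) * (1 / (n * h)) ^ 3 := by
  have hh := ha.pos
  have hn : (0 : ℝ) < n := by exact_mod_cast hτ.pos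
  have hc := hf.pos
  have hMk := hk.nonneg
  have hz : ∀ j, h ≤ |x - designGrid t n j| →
      trapWeight k f t n x h j - kernelWeight f k n (designGrid t n) x h j = 0 := fun j hj => by
    rw [trapWeight, hk.kernelWeight_eq_zero hh hj, mul_zero, sub_zero]
  refine (hτ.sum_abs_le hf ha (B := 1 / (n * h) * (Mk * (1 / (c * (n * h))) ^ 3 * c⁻¹))
    (by positivity) (fun j hj => ?_) fun j _ h => hz j h).trans_eq ?_
  · rcases le_or_gt h |x - designGrid t n j| with hout | hin
    · rw [hz j hout, abs_zero]
      positivity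
    have hin' := abs_lt.1 hin
    have hj0 : 1 ≤ j := by
      by_contra hlt
      obtain rfl : j = 0 := by omega
      rw [hτ.zero] at hin
      exact ha.zero_le_abs.not_gt hin
    have hjn : j + 1 ≤ n := by
      by_contra hlt
      obtain rfl : j = n := by omega
      rw [hτ.last] at hin
      exact ha.one_le_abs.not_gt hin
    have hcoef := trapCoef_mem_Icc (trapIdx t n x h) j
    have hle : |trapWeight k f t n x h j - kernelWeight f k n (designGrid t n) x h j|
        ≤ |kernelWeight f k n (designGrid t n) x h j| := by
      have e : trapWeight k f t n x h j - kernelWeight f k n (designGrid t n) x h j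
          = (trapCoef (trapIdx t n x h) j - 1) * kernelWeight f k n (designGrid t n) x h j := by
        rw [trapWeight]; ring
      rw [e, abs_mul]
      refine mul_le_of_le_one_left (abs_nonneg _) (abs_le.2 ⟨?_, ?_⟩) <;>
        linarith [hcoef.1, hcoef.2]
    have hedge : ∀ e : ℝ, 1 ≤ |e| → |x - designGrid t n j - h * e| ≤ 1 / (c * n) →
        |trapWeight k f t n x h j - kernelWeight f k n (designGrid t n) x h j|
          ≤ 1 / (n * h) * (Mk * (1 / (c * (n * h))) ^ 3 * c⁻¹) := by
      intro e he hd
      refine hle.trans (abs_kernelWeight_le hf hτ hh hj (hk.abs_le_cube he ?_))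
      have e1 : (x - designGrid t n j) / h - e = (x - designGrid t n j - h * e) / h := by
        field_simp
      have e2 : 1 / (c * (n * h)) = 1 / (c * n) / h := by
        field_simp
      rw [e1, e2, abs_div, abs_of_pos hh]
      gcongr
    by_cases h1 : j ∈ trapIdx t n x h
    · by_cases h2 : j - 1 ∈ trapIdx t n x h
      · have : trapCoef (trapIdx t n x h) j = 1 := by
          rw [trapCoef, if_pos h1, if_pos ⟨hj0, h2⟩]
          norm_num
        rw [trapWeight, this, one_mul, sub_self, abs_zero]
        positivity
      · obtain ⟨i, rfl⟩ : ∃ i, j = i + 1 := ⟨j - 1, by omega⟩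
        rw [Nat.add_sub_cancel] at h2
        have hmono := hτ.mono hf (Nat.le_succ i) hj
        have hstep := hτ.step_le hf hj
        have hleft : designGrid t n i ≤ x - h := by
          rcases Nat.eq_zero_or_pos i with rfl | hi
          · rw [hτ.zero]
            exact (ha.window (Set.left_mem_Icc.2 (by linarith))).1
          · rw [mem_trapIdx_iff hi hj] at h2
            by_contra hlt
            exact h2 ⟨⟨by linarith, by linarith⟩, ⟨by linarith, by linarith⟩⟩
        refine hedge 1 (by simp) (abs_le.2 ⟨?_, ?_⟩)
        · linarith
        · have : 0 ≤ 1 / (c * n) := by positivity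
          linarith
    · rw [mem_trapIdx_iff hj0 hjn] at h1
      have hmono := hτ.mono hf (Nat.le_succ j) hjn
      have hstep := hτ.step_le hf hjn
      have hright : x + h ≤ designGrid t n (j + 1) := by
        by_contra hlt
        exact h1 ⟨⟨by linarith, by linarith⟩, ⟨by linarith, by linarith⟩⟩
      refine hedge (-1) (by simp) (abs_le.2 ⟨?_, ?_⟩)
      · have : 0 ≤ 1 / (c * n) := by positivity
        linarith
      · linarith
  · field_simp

end

/-- Bounded partial derivatives on the open triangle `u < v` give a Lipschitz bound there. -/
lemma abs_sub_le_of_partials_triangle {P P1 P2 : ℝ → ℝ → ℝ} {A : ℝ}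
    (h1 : ∀ u v, u < v → HasDerivAt (fun s => P s v) (P1 u v) u)
    (h2 : ∀ u v, u < v → HasDerivAt (fun s => P u s) (P2 u v) v)
    (b1 : ∀ u ∈ Set.Icc (0 : ℝ) 1, ∀ v ∈ Set.Icc (0 : ℝ) 1, u < v → |P1 u v| ≤ A)
    (b2 : ∀ u ∈ Set.Icc (0 : ℝ) 1, ∀ v ∈ Set.Icc (0 : ℝ) 1, u < v → |P2 u v| ≤ A)
    {u v u' v' : ℝ} (hu : u ∈ Set.Icc (0 : ℝ) 1) (hv : v ∈ Set.Icc (0 : ℝ) 1)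
    (hu' : u' ∈ Set.Icc (0 : ℝ) 1) (hv' : v' ∈ Set.Icc (0 : ℝ) 1) (huv : u < v) (huv' : u' < v') :
    |P u v - P u' v'| ≤ A * (|u - u'| + |v - v'|) := by
  have vert : ∀ w ∈ Set.Icc (0 : ℝ) 1, ∀ a ∈ Set.Icc (0 : ℝ) 1, ∀ b ∈ Set.Icc (0 : ℝ) 1,
      w < a → w < b → |P w a - P w b| ≤ A * |a - b| := by
    intro w hw a ha b hb hwa hwb
    refine abs_sub_le_of_abs_hasDerivWithinAt_le (S := Set.Icc 0 1 ∩ Set.Ioi w)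
      (e := fun s => P w s) (e' := P2 w) (Set.ordConnected_Icc.inter Set.ordConnected_Ioi)
      (fun s hs => (h2 w s hs.2).hasDerivWithinAt) (fun s hs => b2 w hw s hs.1 hs.2)
      ⟨ha, hwa⟩ ⟨hb, hwb⟩
  have horiz : ∀ w ∈ Set.Icc (0 : ℝ) 1, ∀ a ∈ Set.Icc (0 : ℝ) 1, ∀ b ∈ Set.Icc (0 : ℝ) 1,
      a < w → b < w → |P a w - P b w| ≤ A * |a - b| := by
    intro w hw a ha b hb hwa hwb
    refine abs_sub_le_of_abs_hasDerivWithinAt_le (S := Set.Icc 0 1 ∩ Set.Iio w)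
      (e := fun s => P s w) (e' := fun s => P1 s w)
      (Set.ordConnected_Icc.inter Set.ordConnected_Iio)
      (fun s hs => (h1 s w hs.2).hasDerivWithinAt) (fun s hs => b1 s hs.1 w hw hs.2)
      ⟨ha, hwa⟩ ⟨hb, hwb⟩
  rcases le_total v v' with hle | hle
  · have := vert u hu v hv v' hv' huv (huv.trans_le hle)
    have := horiz v' hv' u hu u' hu' (huv.trans_le hle) huv'
    have := abs_sub_le (P u v) (P u v') (P u' v')
    linarith
  · have := vert u' hu' v hv v' hv' (huv'.trans_le hle) huv'
    have := horiz v hv u hu u' hu' huv (huv'.trans_le hle)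
    have := abs_sub_le (P u v) (P u' v) (P u' v')
    linarith

lemma abs_sub_le_of_hasDerivWithinAt_of_eventually {φ : ℝ → ℝ} {S : Set ℝ} {x d m a A : ℝ}
    [NeBot (𝓝[S \ {x}] x)] (hd : HasDerivWithinAt φ d S x)
    (he : ∀ᶠ s in 𝓝[S \ {x}] x, |φ s - φ x - m * (s - x)| ≤ (a + A * |s - x|) * |s - x|) :
    |d - m| ≤ a := by
  have h1 : Tendsto (fun s => |slope φ x s - m|) (𝓝[S \ {x}] x) (𝓝 |d - m|) :=
    ((hasDerivWithinAt_iff_tendsto_slope.1 hd).sub_const m).abs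
  have h2 : Tendsto (fun s => a + A * |s - x|) (𝓝[S \ {x}] x) (𝓝 (a + A * |x - x|)) :=
    (Continuous.tendsto (by fun_prop) x).mono_left nhdsWithin_le_nhds
  rw [sub_self, abs_zero, mul_zero, add_zero] at h2
  refine le_of_tendsto_of_tendsto h1 h2 ?_
  filter_upwards [he, self_mem_nhdsWithin] with s hs hmem
  have hne : s - x ≠ 0 := sub_ne_zero.2 hmem.2
  have e : slope φ x s - m = (φ s - φ x - m * (s - x)) / (s - x) := by
    rw [slope_def_field]
    field_simp
  rw [e, abs_div, div_le_iff₀ (abs_pos.2 hne)]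
  exact hs

/-- The partial derivatives up to order two of a symmetric covariance are bounded off the
diagonal, and `Rm`, `Rp` are its one-sided derivatives on the diagonal. -/
structure IsPiecewiseSmoothCov (R R10 R01 R20 R11 R02 : ℝ → ℝ → ℝ) (Rm Rp : ℝ → ℝ) (A : ℝ) :
    Prop where
  cont : ContinuousOn (fun p : ℝ × ℝ => R p.1 p.2) (Set.Icc 0 1 ×ˢ Set.Icc 0 1)
  symm : ∀ s u : ℝ, R s u = R u s
  left : ∀ u ∈ Set.Icc (0:ℝ) 1, HasDerivWithinAt (fun s => R u s) (Rm u) (Set.Iio u) u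
  right : ∀ u ∈ Set.Icc (0:ℝ) 1, HasDerivWithinAt (fun s => R u s) (Rp u) (Set.Ioi u) u
  d10 : ∀ u v : ℝ, u ≠ v → HasDerivAt (fun s => R s v) (R10 u v) u
  d01 : ∀ u v : ℝ, u ≠ v → HasDerivAt (fun s => R u s) (R01 u v) v
  d20 : ∀ u v : ℝ, u ≠ v → HasDerivAt (fun s => R10 s v) (R20 u v) u
  d11 : ∀ u v : ℝ, u ≠ v → HasDerivAt (fun s => R10 u s) (R11 u v) v
  d02 : ∀ u v : ℝ, u ≠ v → HasDerivAt (fun s => R01 u s) (R02 u v) v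
  b20 : ∀ u ∈ Set.Icc (0:ℝ) 1, ∀ v ∈ Set.Icc (0:ℝ) 1, u ≠ v → |R20 u v| ≤ A
  b11 : ∀ u ∈ Set.Icc (0:ℝ) 1, ∀ v ∈ Set.Icc (0:ℝ) 1, u ≠ v → |R11 u v| ≤ A
  b02 : ∀ u ∈ Set.Icc (0:ℝ) 1, ∀ v ∈ Set.Icc (0:ℝ) 1, u ≠ v → |R02 u v| ≤ A

namespace IsPiecewiseSmoothCov

variable {R R10 R01 R20 R11 R02 : ℝ → ℝ → ℝ} {Rm Rp : ℝ → ℝ} {A x h u v : ℝ}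

lemma const_nonneg (hR : IsPiecewiseSmoothCov R R10 R01 R20 R11 R02 Rm Rp A) : 0 ≤ A :=
  (abs_nonneg _).trans (hR.b20 0 (by simp) 1 (by simp) zero_ne_one)

lemma d01_eq_d10 (hR : IsPiecewiseSmoothCov R R10 R01 R20 R11 R02 Rm Rp A) (huv : u ≠ v) :
    R01 u v = R10 v u := by
  have h := hR.d10 v u huv.symm
  simp only [hR.symm _ u] at h
  exact (hR.d01 u v huv).unique h

lemma continuousOn_right (hR : IsPiecewiseSmoothCov R R10 R01 R20 R11 R02 Rm Rp A)
    (hu : u ∈ Set.Icc (0 : ℝ) 1) : ContinuousOn (fun s => R u s) (Set.Icc 0 1) :=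
  hR.cont.comp (f := fun s => (u, s)) (by fun_prop) fun _ hs => ⟨hu, hs⟩

lemma continuousOn_left (hR : IsPiecewiseSmoothCov R R10 R01 R20 R11 R02 Rm Rp A)
    (hu : u ∈ Set.Icc (0 : ℝ) 1) : ContinuousOn (fun s => R s u) (Set.Icc 0 1) :=
  hR.cont.comp (f := fun s => (s, u)) (by fun_prop) fun _ hs => ⟨hs, hu⟩

lemma abs_d01_sub_le (hR : IsPiecewiseSmoothCov R R10 R01 R20 R11 R02 Rm Rp A)
    (hx : x ∈ Set.Ioo (0 : ℝ) 1) (hu : u ∈ Set.Icc (0 : ℝ) 1) (hv : v ∈ Set.Icc (0 : ℝ) 1)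
    (huv : u < v) : |R01 u v - Rp x| ≤ A * (|u - x| + |v - x|) := by
  have hA := hR.const_nonneg
  have hx' : x ∈ Set.Icc (0 : ℝ) 1 := ⟨hx.1.le, hx.2.le⟩
  have hd := hR.right x hx'
  have hS : Set.Ioi x \ {x} = Set.Ioi x := by simp
  rw [abs_sub_comm]
  have : NeBot (𝓝[Set.Ioi x \ {x}] x) := by rw [hS]; infer_instance
  refine abs_sub_le_of_hasDerivWithinAt_of_eventually (A := A) hd ?_
  rw [hS]
  filter_upwards [Ioo_mem_nhdsGT hx.2] with s hs
  have hsub : Set.Icc x s ⊆ Set.Icc 0 1 := Set.Icc_subset_Icc hx.1.le hs.2.le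
  have key := abs_sub_le_of_abs_hasDerivAt_le (e := fun r => R x r - R01 u v * r)
    (e' := fun r => R01 x r - R01 u v) (B := A * (|u - x| + |v - x|) + A * |s - x|) hs.1.le
    (((hR.continuousOn_right hx').mono hsub).sub (by fun_prop))
    (fun r hr => (hR.d01 x r hr.1.ne).sub (by simpa using (hasDerivAt_id r).const_mul (R01 u v)))
    (fun r hr => by
      have hr' := hsub ⟨hr.1.le, hr.2.le⟩
      have := abs_sub_le_of_partials_triangle (P := R01) (P1 := fun u v => R11 v u) (P2 := R02)
        (fun u v huv => by
          have h := hR.d11 v u huv.ne'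
          refine h.congr_of_eventuallyEq ?_
          filter_upwards [gt_mem_nhds huv] with s hs
          exact hR.d01_eq_d10 hs.ne)
        (fun u v huv => hR.d02 u v huv.ne) (fun u hu v hv huv => hR.b11 v hv u hu huv.ne')
        (fun u hu v hv huv => hR.b02 u hu v hv huv.ne) hx' hr' hu hv hr.1 huv
      refine this.trans ?_
      rw [abs_sub_comm x u, abs_sub_comm r v, ← mul_add, add_assoc]
      gcongr
      have h3 := abs_sub_le v x r
      rw [abs_sub_comm x r, abs_of_pos (sub_pos.2 hr.1)] at h3
      rw [abs_of_pos (sub_pos.2 hs.1)]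
      linarith [hr.2])
  have e : R x s - R x x - R01 u v * (s - x) = R x s - R01 u v * s - (R x x - R01 u v * x) := by
    ring
  rw [e, abs_of_pos (sub_pos.2 hs.1)]
  rw [abs_of_pos (sub_pos.2 hs.1)] at key
  exact key

lemma abs_d10_sub_le (hR : IsPiecewiseSmoothCov R R10 R01 R20 R11 R02 Rm Rp A)
    (hx : x ∈ Set.Ioo (0 : ℝ) 1) (hu : u ∈ Set.Icc (0 : ℝ) 1) (hv : v ∈ Set.Icc (0 : ℝ) 1)
    (huv : u < v) : |R10 u v - Rm x| ≤ A * (|u - x| + |v - x|) := by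
  have hA := hR.const_nonneg
  have hx' : x ∈ Set.Icc (0 : ℝ) 1 := ⟨hx.1.le, hx.2.le⟩
  have hd := hR.left x hx'
  have hS : Set.Iio x \ {x} = Set.Iio x := by simp
  rw [abs_sub_comm]
  have : NeBot (𝓝[Set.Iio x \ {x}] x) := by rw [hS]; infer_instance
  refine abs_sub_le_of_hasDerivWithinAt_of_eventually (A := A) hd ?_
  rw [hS]
  filter_upwards [Ioo_mem_nhdsLT hx.1] with s hs
  have hsub : Set.Icc s x ⊆ Set.Icc 0 1 := Set.Icc_subset_Icc hs.1.le hx.2.le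
  have key := abs_sub_le_of_abs_hasDerivAt_le (e := fun r => R x r - R10 u v * r)
    (e' := fun r => R01 x r - R10 u v) (B := A * (|u - x| + |v - x|) + A * |s - x|) hs.2.le
    (((hR.continuousOn_right hx').mono hsub).sub (by fun_prop))
    (fun r hr => (hR.d01 x r hr.2.ne').sub (by simpa using (hasDerivAt_id r).const_mul (R10 u v)))
    (fun r hr => by
      have hr' := hsub ⟨hr.1.le, hr.2.le⟩
      have := abs_sub_le_of_partials_triangle (P := R10) (P1 := R20) (P2 := R11)
        (fun u v huv => hR.d20 u v huv.ne) (fun u v huv => hR.d11 u v huv.ne)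
        (fun u hu v hv huv => hR.b20 u hu v hv huv.ne)
        (fun u hu v hv huv => hR.b11 u hu v hv huv.ne) hr' hx' hu hv hr.2 huv
      rw [hR.d01_eq_d10 hr.2.ne']
      refine this.trans ?_
      rw [abs_sub_comm r u, abs_sub_comm x v, ← mul_add]
      refine mul_le_mul_of_nonneg_left ?_ hA
      have h3 := abs_sub_le u x r
      rw [abs_of_pos (sub_pos.2 hr.2)] at h3
      rw [abs_of_neg (sub_neg.2 hs.2)]
      linarith [hr.1])
  have e : R x s - R x x - R10 u v * (s - x)
      = -(R x x - R10 u v * x - (R x s - R10 u v * s)) := by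
    ring
  rw [e, abs_neg, abs_of_neg (sub_neg.2 hs.2), neg_sub]
  rw [abs_of_neg (sub_neg.2 hs.2), neg_sub] at key
  exact key

lemma abs_sub_le_of_le (hR : IsPiecewiseSmoothCov R R10 R01 R20 R11 R02 Rm Rp A)
    (hx : x ∈ Set.Ioo (0 : ℝ) 1) (hh : 0 < h) (hW : Set.Icc (x - h) (x + h) ⊆ Set.Icc (0 : ℝ) 1)
    (hu : u ∈ Set.Icc (x - h) (x + h)) (hv : v ∈ Set.Icc (x - h) (x + h)) (huv : u ≤ v) :
    |R u v - R x x - Rm x * (u - x) - Rp x * (v - x)| ≤ 8 * A * h ^ 2 := by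
  have hA := hR.const_nonneg
  have hsum : ∀ a ∈ Set.Icc (x - h) (x + h), ∀ b ∈ Set.Icc (x - h) (x + h),
      A * (|a - x| + |b - x|) ≤ 2 * A * h := by
    intro a ha b hb
    have h1 : |a - x| ≤ h := abs_le.2 ⟨by linarith [ha.1], by linarith [ha.2]⟩
    have h2 : |b - x| ≤ h := abs_le.2 ⟨by linarith [hb.1], by linarith [hb.2]⟩
    nlinarith
  have vert : ∀ w ∈ Set.Icc (x - h) (x + h), ∀ a, w ≤ a → a ≤ x + h →
      |R w (x + h) - R w a - Rp x * (x + h - a)| ≤ 2 * A * h * (x + h - a) := by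
    intro w hw a hwa hah
    have key := abs_sub_le_of_abs_hasDerivAt_le (e := fun r => R w r - Rp x * r)
      (e' := fun r => R01 w r - Rp x) (B := 2 * A * h) hah
      (((hR.continuousOn_right (hW hw)).mono
        ((Set.Icc_subset_Icc_left (hw.1.trans hwa)).trans hW)).sub (by fun_prop))
      (fun r hr => (hR.d01 w r (hwa.trans_lt hr.1).ne).sub
        (by simpa using (hasDerivAt_id r).const_mul (Rp x)))
      (fun r hr => by
        have hr' : r ∈ Set.Icc (x - h) (x + h) := ⟨by linarith [hw.1, hr.1], hr.2.le⟩
        exact (hR.abs_d01_sub_le hx (hW hw) (hW hr') (hwa.trans_lt hr.1)).trans (hsum _ hw _ hr'))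
    have e : R w (x + h) - R w a - Rp x * (x + h - a)
        = R w (x + h) - Rp x * (x + h) - (R w a - Rp x * a) := by ring
    rw [e]
    exact key
  have horiz : ∀ a ∈ Set.Icc (x - h) (x + h), ∀ b ∈ Set.Icc (x - h) (x + h), a ≤ b →
      |R b (x + h) - R a (x + h) - Rm x * (b - a)| ≤ 2 * A * h * (b - a) := by
    intro a ha b hb hab
    have hr0 : x + h ∈ Set.Icc (x - h) (x + h) := ⟨by linarith, le_rfl⟩
    have key := abs_sub_le_of_abs_hasDerivAt_le (e := fun r => R r (x + h) - Rm x * r)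
      (e' := fun r => R10 r (x + h) - Rm x) (B := 2 * A * h) hab
      (((hR.continuousOn_left (hW hr0)).mono
        ((Set.Icc_subset_Icc ha.1 hb.2).trans hW)).sub (by fun_prop))
      (fun r hr => (hR.d10 r (x + h) (hr.2.trans_le hb.2).ne).sub
        (by simpa using (hasDerivAt_id r).const_mul (Rm x)))
      (fun r hr => by
        have hr' : r ∈ Set.Icc (x - h) (x + h) :=
          ⟨by linarith [ha.1, hr.1], by linarith [hb.2, hr.2]⟩
        exact (hR.abs_d10_sub_le hx (hW hr') (hW hr0) (hr.2.trans_le hb.2)).trans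
          (hsum _ hr' _ hr0))
    have e : R b (x + h) - R a (x + h) - Rm x * (b - a)
        = R b (x + h) - Rm x * b - (R a (x + h) - Rm x * a) := by ring
    rw [e]
    exact key
  have hxW : x ∈ Set.Icc (x - h) (x + h) := ⟨by linarith, by linarith⟩
  have k1 := vert x hxW x le_rfl hxW.2
  have k3 := vert u hu v huv hv.2
  have k2 : |R u (x + h) - R x (x + h) - Rm x * (u - x)| ≤ 2 * A * h * h := by
    rcases le_total x u with hle | hle
    · refine (horiz x hxW u hu hle).trans ?_
      gcongr
      linarith [hu.2]
    · have h1 := horiz u hu x hxW hle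
      have e : R u (x + h) - R x (x + h) - Rm x * (u - x)
        = -(R x (x + h) - R u (x + h) - Rm x * (x - u)) := by ring
      rw [e, abs_neg]
      refine h1.trans ?_
      gcongr
      linarith [hu.1]
  have k3' : |R u (x + h) - R u v - Rp x * (x + h - v)| ≤ 2 * A * h * (2 * h) := by
    refine k3.trans ?_
    gcongr
    linarith [hv.1]
  rw [add_sub_cancel_left] at k1
  have e : R u v - R x x - Rm x * (u - x) - Rp x * (v - x)
      = (R x (x + h) - R x x - Rp x * h) + (R u (x + h) - R x (x + h) - Rm x * (u - x))
        - (R u (x + h) - R u v - Rp x * (x + h - v)) := by ring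
  rw [e]
  refine (abs_sub _ _).trans ?_
  have := abs_add_le (R x (x + h) - R x x - Rp x * h) (R u (x + h) - R x (x + h) - Rm x * (u - x))
  nlinarith

/-- First-order expansion of the covariance at a diagonal point, with the jump of the derivative
as coefficient of `|u - v|`. -/
theorem abs_expansion_le (hR : IsPiecewiseSmoothCov R R10 R01 R20 R11 R02 Rm Rp A)
    (hx : x ∈ Set.Ioo (0 : ℝ) 1) (hh : 0 < h) (hW : Set.Icc (x - h) (x + h) ⊆ Set.Icc (0 : ℝ) 1)
    (hu : u ∈ Set.Icc (x - h) (x + h)) (hv : v ∈ Set.Icc (x - h) (x + h)) :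
    |R u v - (R x x + (Rm x + Rp x) / 2 * ((u - x) + (v - x)) - (Rm x - Rp x) / 2 * |u - v|)|
      ≤ 8 * A * h ^ 2 := by
  rcases le_total u v with huv | huv
  · convert hR.abs_sub_le_of_le hx hh hW hu hv huv using 2
    rw [abs_of_nonpos (sub_nonpos.2 huv)]
    ring
  · convert hR.abs_sub_le_of_le hx hh hW hv hu huv using 2
    rw [abs_of_nonneg (sub_nonneg.2 huv), hR.symm u v]
    ring

end IsPiecewiseSmoothCov

/-- Second-order Taylor expansion. -/
lemma ScaledC2.abs_taylor_le {S : Set ℝ} {M x s : ℝ} {G G1 G2 : ℝ → ℝ}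
    (hG : ScaledC2 S M 1 G G1 G2) (hS : S.OrdConnected) (hM : 0 ≤ M) (hx : x ∈ S) (hs : s ∈ S) :
    |G s - (G x + G1 x * (s - x) + G2 x / 2 * (s - x) ^ 2)| ≤ M * |s - x| ^ 3 := by
  set d := |s - x| with hd
  have hd0 : 0 ≤ d := abs_nonneg _
  set T := S ∩ Set.Icc (x - d) (x + d)
  have hT : T.OrdConnected := hS.inter Set.ordConnected_Icc
  have hmem : ∀ u ∈ T, |u - x| ≤ d := fun u hu =>
    abs_le.2 ⟨by linarith [hu.2.1], by linarith [hu.2.2]⟩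
  have hxT : x ∈ T := ⟨hx, by linarith, by linarith⟩
  have hsT : s ∈ T := by
    have := abs_le.1 hd.ge
    exact ⟨hs, by linarith, by linarith⟩
  have b2 : ∀ u ∈ T, |G2 u - G2 x| ≤ M * d := fun u hu => by
    have := hG.lip2 u hu.1 x hx
    rw [one_pow, div_one] at this
    exact this.trans (mul_le_mul_of_nonneg_left (hmem u hu) hM)
  have b1 : ∀ u ∈ T, |G1 u - (G1 x + G2 x * (u - x))| ≤ M * d * d := fun u hu => by
    have := abs_sub_le_of_abs_hasDerivWithinAt_le hT
      (e := fun u => G1 u - (G1 x + G2 x * (u - x)))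
      (fun u hu => ((hG.deriv1 u hu.1).mono Set.inter_subset_left).sub
        (((((hasDerivAt_id u).sub_const x).const_mul (G2 x)).const_add (G1 x)).congr_deriv
          (mul_one (G2 x))).hasDerivWithinAt) b2 hu hxT
    simp only [sub_self, mul_zero, add_zero, sub_zero] at this
    exact this.trans (mul_le_mul_of_nonneg_left (hmem u hu) (by positivity))
  have := abs_sub_le_of_abs_hasDerivWithinAt_le hT
      (e := fun u => G u - (G x + G1 x * (u - x) + G2 x / 2 * (u - x) ^ 2))
      (fun u hu => ((hG.deriv u hu.1).mono Set.inter_subset_left).sub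
        (((((hasDerivAt_id u).sub_const x).const_mul (G1 x)).const_add (G x)).add
          ((((hasDerivAt_id u).sub_const x).pow 2).const_mul (G2 x / 2))
            |>.congr_deriv (by simp; ring :
              _ = G1 x + G2 x * (u - x))).hasDerivWithinAt) b1 hsT hxT
  simp only [sub_self, mul_zero, add_zero, ne_eq, OfNat.ofNat_ne_zero, not_false_eq_true,
    zero_pow] at this
  rw [sub_zero] at this
  refine this.trans_eq ?_
  rw [← hd]
  ring

lemma IsSmoothKernel.abs_integral_mul_sub_le {Mk E : ℝ} {k k1 k2 G P : ℝ → ℝ}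
    (hk : IsSmoothKernel Mk k k1 k2) (hG : ContinuousOn G (Set.Icc (-1) 1))
    (hP : ContinuousOn P (Set.Icc (-1) 1)) (hE : ∀ z ∈ Set.Icc (-1 : ℝ) 1, |G z - P z| ≤ E) :
    |(∫ z in (-1)..1, k z * G z) - ∫ z in (-1)..1, k z * P z| ≤ 2 * (Mk * E) := by
  have hle : (-1 : ℝ) ≤ 1 := by norm_num
  have hi : ∀ {w : ℝ → ℝ}, ContinuousOn w (Set.Icc (-1) 1) →
      IntervalIntegrable (fun z => k z * w z) volume (-1) 1 := fun {w} hw =>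
    ContinuousOn.intervalIntegrable (by
      rw [Set.uIcc_of_le hle]
      exact hk.continuous.continuousOn.mul hw)
  rw [← intervalIntegral.integral_sub (hi hG) (hi hP)]
  have := intervalIntegral.norm_integral_le_of_norm_le_const (a := -1) (b := 1) (C := Mk * E)
    (f := fun z => k z * G z - k z * P z) (fun z hz => by
      rw [Set.uIoc_of_le hle] at hz
      rw [← mul_sub, norm_mul]
      exact mul_le_mul (hk.abs_le z) (hE z ⟨hz.1.le, hz.2⟩) (norm_nonneg _) hk.nonneg)
  refine this.trans_eq ?_
  norm_num
  ring

lemma integral_mul_id_eq_zero_of_even {K : ℝ → ℝ} (hK : ∀ u, K (-u) = K u) :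
    ∫ z in (-1 : ℝ)..1, K z * z = 0 := by
  have h := intervalIntegral.integral_comp_neg (a := -1) (b := 1) fun z => K z * z
  simp only [hK, neg_neg, mul_neg, intervalIntegral.integral_neg] at h
  linarith

lemma Admissible.sub_mul_mem {n : ℕ} {x h z : ℝ} (ha : Admissible n x h)
    (hz : z ∈ Set.Icc (-1 : ℝ) 1) : x - h * z ∈ Set.Icc (0 : ℝ) 1 :=
  ha.window ⟨by nlinarith [ha.pos, hz.2], by nlinarith [ha.pos, hz.1]⟩

lemma ScaledC2.continuousOn {S : Set ℝ} {M h : ℝ} {G G1 G2 : ℝ → ℝ}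
    (hG : ScaledC2 S M h G G1 G2) : ContinuousOn G S := fun s hs =>
  (hG.deriv s hs).continuousWithinAt

lemma ScaledC2.continuousOn_comp {M x h : ℝ} {n : ℕ} {G G1 G2 : ℝ → ℝ}
    (hG : ScaledC2 (Set.Icc 0 1) M 1 G G1 G2) (ha : Admissible n x h) :
    ContinuousOn (fun z => G (x - h * z)) (Set.Icc (-1) 1) :=
  hG.continuousOn.comp (by fun_prop) fun _ hz => ha.sub_mul_mem hz

/-- Expansion of a kernel average in powers of the bandwidth. -/
lemma abs_kernel_average_sub_le {Mk Mg x h : ℝ} {n : ℕ} {k k1 k2 g g1 g2 : ℝ → ℝ}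
    (hk : IsSmoothKernel Mk k k1 k2) (heven : ∀ u, k (-u) = k u) (hint_eq : ∫ z in (-1)..1, k z = 1)
    (hg : ScaledC2 (Set.Icc 0 1) Mg 1 g g1 g2) (hMg : 0 ≤ Mg) (ha : Admissible n x h) :
    |(∫ z in (-1)..1, k z * g (x - h * z))
        - (g x + 1 / 2 * h ^ 2 * g2 x * ∫ z in (-1)..1, z ^ 2 * k z)|
      ≤ 2 * (Mk * (Mg * h ^ 3)) := by
  have hh := ha.pos
  have hx : x ∈ Set.Icc (0 : ℝ) 1 := by simpa using ha.sub_mul_mem (z := 0) (by norm_num)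
  have key := hk.abs_integral_mul_sub_le (hg.continuousOn_comp ha)
    (P := fun z => g x + g1 x * (x - h * z - x) + g2 x / 2 * (x - h * z - x) ^ 2) (by fun_prop)
    (E := Mg * h ^ 3) (fun z hz => by
      refine (hg.abs_taylor_le Set.ordConnected_Icc hMg hx (ha.sub_mul_mem hz)).trans ?_
      have e : x - h * z - x = -(h * z) := by ring
      have hz' : |z| ≤ 1 := abs_le.2 hz
      rw [e, abs_neg, abs_mul, abs_of_pos hh]
      have : h * |z| ≤ h := mul_le_of_le_one_right hh.le hz'
      gcongr)
  have e : ∫ z in (-1)..1, k z * (g x + g1 x * (x - h * z - x) + g2 x / 2 * (x - h * z - x) ^ 2)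
      = g x + 1 / 2 * h ^ 2 * g2 x * ∫ z in (-1)..1, z ^ 2 * k z := by
    have hc := hk.continuous
    have e1 : ∀ z, k z * (g x + g1 x * (x - h * z - x) + g2 x / 2 * (x - h * z - x) ^ 2)
        = g x * k z - g1 x * h * (k z * z) + 1 / 2 * h ^ 2 * g2 x * (z ^ 2 * k z) := fun z => by
      ring
    simp only [e1]
    rw [intervalIntegral.integral_add (Continuous.intervalIntegrable (by fun_prop) _ _)
      (Continuous.intervalIntegrable (by fun_prop) _ _),
      intervalIntegral.integral_sub (Continuous.intervalIntegrable (by fun_prop) _ _)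
      (Continuous.intervalIntegrable (by fun_prop) _ _),
      intervalIntegral.integral_const_mul, intervalIntegral.integral_const_mul,
      intervalIntegral.integral_const_mul, integral_mul_id_eq_zero_of_even heven, hint_eq]
    ring
  rwa [e] at key

section

variable {f i1 i2 : ℝ → ℝ} {c N Mi : ℝ} {Mk : ℝ} {k k1 k2 : ℝ → ℝ} {t : ℕ → ℕ → ℝ}

/-- Expansion of the expectation of the trapezoidal estimator. -/
theorem exists_abs_trapSum_sub_le (hf : BoundedDensity f c N)
    (hi : ScaledC2 (Set.Icc 0 1) Mi 1 (fun s => (f s)⁻¹) i1 i2) (hMi : 0 ≤ Mi)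
    (hk : IsSmoothKernel Mk k k1 k2) (heven : ∀ u, k (-u) = k u) (hint_eq : ∫ z in (-1)..1, k z = 1)
    {Mg : ℝ} {g g1 g2 : ℝ → ℝ} (hg : ScaledC2 (Set.Icc 0 1) Mg 1 g g1 g2) (hMg : 0 ≤ Mg) (x : ℝ) :
    ∃ C, 0 ≤ C ∧ ∀ (n : ℕ) (h : ℝ), IsQuantileGrid f n (designGrid t n) → Admissible n x h →
      |trapSum t n x h (fun s => phiK k x h s * g s / f s)
          - (g x + 1 / 2 * h ^ 2 * g2 x * ∫ z in (-1)..1, z ^ 2 * k z)|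
        ≤ C * (h ^ 3 + (1 / (n * h)) ^ 3) := by
  have hMk := hk.nonneg
  have hN := hf.nonneg
  have hc := hf.pos
  have hT := trapConst_nonneg hf hMi
  refine ⟨(2 * N + 2) * (Mk * c⁻¹ ^ 4) * Mg + trapConst c N Mi * Mk * Mg + 2 * (Mk * Mg),
    by positivity, fun n h hτ ha => ?_⟩
  have hh := ha.pos
  have k1 := abs_sum_kernelWeight_mul_sub_le hf hi hMi hτ ha hk hg hMg
  have k2 := abs_kernel_average_sub_le hk heven hint_eq hg hMg ha
  have k3 : |∑ j ∈ Finset.range (n + 1), trapWeight k f t n x h j * g (designGrid t n j)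
      - ∑ j ∈ Finset.range (n + 1), kernelWeight f k n (designGrid t n) x h j
          * g (designGrid t n j)| ≤ (2 * N + 2) * (Mk * c⁻¹ ^ 4) * (1 / (n * h)) ^ 3 * Mg := by
    rw [← Finset.sum_sub_distrib]
    refine (Finset.abs_sum_le_sum_abs _ _).trans (le_trans ?_
      (mul_le_mul_of_nonneg_right (sum_abs_trapWeight_sub_kernelWeight_le hf hτ ha hk) hMg))
    rw [Finset.sum_mul]
    refine Finset.sum_le_sum fun j hj => ?_
    rw [← sub_mul, abs_mul]
    exact mul_le_mul_of_nonneg_left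
      (hg.bound _ (hτ.mem j (Nat.lt_succ_iff.1 (Finset.mem_range.1 hj)))) (abs_nonneg _)
  rw [trapSum_eq_sum_trapWeight]
  set η := (1 / ((n : ℝ) * h)) ^ 3
  have hη : 0 ≤ η := by positivity
  refine (abs_sub_le _ _ _).trans ((add_le_add k3 ((abs_sub_le _ _ _).trans
    (add_le_add k1 k2))).trans ?_)
  have h3 : 0 ≤ h ^ 3 := by positivity
  have a1 : 0 ≤ ((2 * N + 2) * (Mk * c⁻¹ ^ 4) * Mg + trapConst c N Mi * Mk * Mg) * h ^ 3 := by
    positivity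
  have a2 : 0 ≤ 2 * (Mk * Mg) * η := by positivity
  nlinarith

/-- Expansion of the mean distance between two weighted design points. -/
theorem exists_abs_sum_sum_kernelWeight_mul_abs_sub_le (hf : BoundedDensity f c N)
    (hi : ScaledC2 (Set.Icc 0 1) Mi 1 (fun s => (f s)⁻¹) i1 i2) (hMi : 0 ≤ Mi)
    (hk : IsSmoothKernel Mk k k1 k2) (hint_eq : ∫ z in (-1)..1, k z = 1) (x : ℝ) :
    ∃ C, 0 ≤ C ∧ ∀ (n : ℕ) (h : ℝ) (τ : ℕ → ℝ), IsQuantileGrid f n τ → Admissible n x h →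
      |∑ i ∈ Finset.range (n + 1), ∑ j ∈ Finset.range (n + 1),
          kernelWeight f k n τ x h i * kernelWeight f k n τ x h j * |τ i - τ j|
        - (h * (∫ u in (-1)..1, ∫ v in (-1)..1, |u - v| * k u * k v)
          - 1 / (6 * n ^ 2 * h) * ((∫ u in (-1)..1, k u ^ 2) * (f x)⁻¹ ^ 2))|
        ≤ C * (h ^ 2 + (1 / (n * h)) ^ 3) := by
  obtain ⟨Mρ, ρ1, ρ2, hρ⟩ := hk.exists_mul_kernelDist hint_eq
  obtain ⟨Mq, q1, q2, hq⟩ := hk.exists_sq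
  have hMk := hk.nonneg
  have hMρ := hρ.nonneg
  have hMq := hq.nonneg
  have hN := hf.nonneg
  have hc := hf.pos
  have hT := trapConst_nonneg hf hMi
  have hone : ScaledC2 (Set.Icc 0 1) 1 1 (fun _ => 1) (fun _ => 0) (fun _ => 0) :=
    ⟨fun s _ => hasDerivWithinAt_const _ _ _, fun s _ => hasDerivWithinAt_const _ _ _,
      by simp, by simp, by simp, by simp⟩
  have hinv2 := hi.mul hi Set.ordConnected_Icc hMi hMi one_pos
  have hM2 : 0 ≤ 8 * Mi * Mi := by positivity
  set T := trapConst c N Mi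
  refine ⟨(2 * N + 2) * (Mk * c⁻¹) * (2 * T * Mk) + T * Mρ + T * Mq * (8 * Mi * Mi)
    + 2 * (Mq * (8 * Mi * Mi)), by positivity, fun n h τ hτ ha => ?_⟩
  have hh := ha.pos
  have hn : (0 : ℝ) < n := by exact_mod_cast hτ.pos
  have hx : x ∈ Set.Icc (0 : ℝ) 1 := by simpa using ha.sub_mul_mem (z := 0) (by norm_num)
  set η := (1 / ((n : ℝ) * h)) ^ 3
  have hη : 0 ≤ η := by positivity
  have s1 : |∑ i ∈ Finset.range (n + 1), ∑ j ∈ Finset.range (n + 1),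
          kernelWeight f k n τ x h i * kernelWeight f k n τ x h j * |τ i - τ j|
      - ∑ i ∈ Finset.range (n + 1), kernelWeight f k n τ x h i * (h * kernelDist k ((x - τ i) / h)
          - 1 / (6 * n ^ 2 * h) * (k ((x - τ i) / h) * (f (τ i))⁻¹ ^ 2))|
      ≤ (2 * N + 2) * (Mk * c⁻¹) * (2 * T * Mk * η) := by
    rw [← Finset.sum_sub_distrib]
    refine (Finset.abs_sum_le_sum_abs _ _).trans (le_trans ?_
      (mul_le_mul_of_nonneg_right (sum_abs_kernelWeight_le hf hτ ha hk) (by positivity)))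
    rw [Finset.sum_mul]
    refine Finset.sum_le_sum fun i hi' => ?_
    have := abs_sum_kernelWeight_mul_abs_sub_le hf hi hMi hτ ha hk
      (Nat.lt_succ_iff.1 (Finset.mem_range.1 hi'))
    simp only [mul_assoc (kernelWeight f k n τ x h i)]
    rw [← Finset.mul_sum, ← mul_sub, abs_mul]
    refine mul_le_mul_of_nonneg_left ?_ (abs_nonneg _)
    rw [← sub_add]
    exact this
  have s2 : ∑ i ∈ Finset.range (n + 1), kernelWeight f k n τ x h i
        * (h * kernelDist k ((x - τ i) / h)
          - 1 / (6 * n ^ 2 * h) * (k ((x - τ i) / h) * (f (τ i))⁻¹ ^ 2))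
      = h * (∑ i ∈ Finset.range (n + 1),
          kernelWeight f (fun s => k s * kernelDist k s) n τ x h i * 1)
        - 1 / (6 * n ^ 2 * h) * ∑ i ∈ Finset.range (n + 1),
          kernelWeight f (fun s => k s ^ 2) n τ x h i * ((f (τ i))⁻¹ * (f (τ i))⁻¹) := by
    rw [Finset.mul_sum, Finset.mul_sum, ← Finset.sum_sub_distrib]
    refine Finset.sum_congr rfl fun i _ => ?_
    unfold kernelWeight
    ring
  have s3 := abs_sum_kernelWeight_mul_sub_le hf hi hMi hτ ha hρ hone zero_le_one
  have s4 := abs_sum_kernelWeight_mul_sub_le hf hi hMi hτ ha hq hinv2 hM2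
  have e3 : ∫ z in (-1)..1, k z * kernelDist k z * 1
      = ∫ u in (-1)..1, ∫ v in (-1)..1, |u - v| * k u * k v := by
    refine intervalIntegral.integral_congr fun u hu => ?_
    rw [Set.uIcc_of_le (by norm_num)] at hu
    simp only [kernelDist_eq_integral_abs hk.continuous hu, mul_one]
    rw [← intervalIntegral.integral_const_mul]
    refine intervalIntegral.integral_congr fun v _ => ?_
    ring
  have s5 := hq.abs_integral_mul_sub_le (hinv2.continuousOn_comp ha)
    (P := fun _ => (f x)⁻¹ * (f x)⁻¹) continuousOn_const (E := 8 * Mi * Mi * h) (fun z hz => by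
      have := hinv2.lip0 Set.ordConnected_Icc (ha.sub_mul_mem hz) hx
      rw [div_one] at this
      refine this.trans (mul_le_mul_of_nonneg_left ?_ hM2)
      have e : x - h * z - x = -(h * z) := by ring
      rw [e, abs_neg, abs_mul, abs_of_pos hh]
      exact mul_le_of_le_one_right hh.le (abs_le.2 hz))
  rw [intervalIntegral.integral_mul_const] at s5
  rw [e3] at s3
  rw [s2] at s1
  set X1 := ∑ i ∈ Finset.range (n + 1),
    kernelWeight f (fun s => k s * kernelDist k s) n τ x h i * 1
  set X2 := ∑ i ∈ Finset.range (n + 1),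
          kernelWeight f (fun s => k s ^ 2) n τ x h i * ((f (τ i))⁻¹ * (f (τ i))⁻¹)
  set D := ∑ i ∈ Finset.range (n + 1), ∑ j ∈ Finset.range (n + 1),
          kernelWeight f k n τ x h i * kernelWeight f k n τ x h j * |τ i - τ j|
  set CK := ∫ u in (-1)..1, ∫ v in (-1)..1, |u - v| * k u * k v
  set V := ∫ u in (-1)..1, k u ^ 2
  have s6 : |X2 - V * ((f x)⁻¹ * (f x)⁻¹)|
      ≤ T * Mq * (8 * Mi * Mi) * η + 2 * (Mq * (8 * Mi * Mi * h)) :=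
    (abs_sub_le _ _ _).trans (add_le_add s4 s5)
  have hq0 : 0 ≤ 1 / (6 * (n : ℝ) ^ 2 * h) := by positivity
  have hqh : 1 / (6 * (n : ℝ) ^ 2 * h) ≤ h := by
    rw [div_le_iff₀ (by positivity)]
    nlinarith [ha.one_le]
  have hq1 : 1 / (6 * (n : ℝ) ^ 2 * h) ≤ 1 := hqh.trans ha.le_one
  set q := 1 / (6 * (n : ℝ) ^ 2 * h)
  have e : D - (h * CK - q * (V * (f x)⁻¹ ^ 2))
      = (D - (h * X1 - q * X2)) + h * (X1 - CK) - q * (X2 - V * ((f x)⁻¹ * (f x)⁻¹)) := by ring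
  have t1 : |h * (X1 - CK)| ≤ T * Mρ * η := by
    rw [abs_mul, abs_of_pos hh]
    refine (mul_le_of_le_one_left (abs_nonneg _) ha.le_one).trans ?_
    exact s3.trans_eq (by rw [mul_one])
  have t2 : |q * (X2 - V * ((f x)⁻¹ * (f x)⁻¹))|
      ≤ T * Mq * (8 * Mi * Mi) * η + 2 * (Mq * (8 * Mi * Mi)) * h ^ 2 := by
    rw [abs_mul, abs_of_nonneg hq0]
    refine (mul_le_mul_of_nonneg_left s6 hq0).trans ?_
    rw [mul_add]
    refine add_le_add (mul_le_of_le_one_left (by positivity) hq1)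
      ((mul_le_mul_of_nonneg_right hqh (by positivity)).trans_eq (by ring))
  rw [e]
  refine (abs_sub _ _).trans ((add_le_add (abs_add_le _ _) le_rfl).trans
    ((add_le_add (add_le_add s1 t1) t2).trans ?_))
  have a1 : 0 ≤ ((2 * N + 2) * (Mk * c⁻¹) * (2 * T * Mk) + T * Mρ + T * Mq * (8 * Mi * Mi))
      * h ^ 2 := by positivity
  have a2 : 0 ≤ 2 * (Mq * (8 * Mi * Mi)) * η := by positivity
  linarith

end

lemma abs_sum_sum_le_of_abs_le_mul {ι : Type*} {s : Finset ι} {F : ι → ι → ℝ} {p q : ι → ℝ}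
    {ε P Q : ℝ} (hF : ∀ i ∈ s, ∀ j ∈ s, |F i j| ≤ |p i| * |q j| * ε) (hε : 0 ≤ ε)
    (hP : ∑ i ∈ s, |p i| ≤ P) (hQ : ∑ j ∈ s, |q j| ≤ Q) :
    |∑ i ∈ s, ∑ j ∈ s, F i j| ≤ P * Q * ε := by
  have h1 : ∑ i ∈ s, ∑ j ∈ s, |p i| * |q j| * ε = (∑ i ∈ s, |p i|) * (∑ j ∈ s, |q j|) * ε := by
    rw [Finset.sum_mul_sum, Finset.sum_mul]
    exact Finset.sum_congr rfl fun i _ => by rw [Finset.sum_mul]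
  have hp : 0 ≤ ∑ i ∈ s, |p i| := Finset.sum_nonneg fun _ _ => abs_nonneg _
  have hq : 0 ≤ ∑ i ∈ s, |q i| := Finset.sum_nonneg fun _ _ => abs_nonneg _
  refine (Finset.abs_sum_le_sum_abs _ _).trans ((Finset.sum_le_sum fun i hi =>
    (Finset.abs_sum_le_sum_abs _ _).trans (Finset.sum_le_sum fun j hj => hF i hi j hj)).trans ?_)
  rw [h1]
  exact mul_le_mul_of_nonneg_right (mul_le_mul hP hQ hq (hp.trans hP)) hε

section

variable {f i1 i2 : ℝ → ℝ} {c N Mi : ℝ} {Mk : ℝ} {k k1 k2 : ℝ → ℝ} {t : ℕ → ℕ → ℝ}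
  {R R10 R01 R20 R11 R02 : ℝ → ℝ → ℝ} {Rm Rp : ℝ → ℝ} {A x : ℝ}

/-- Expansion of the quadratic form with the kernel weights in place of the trapezoidal ones. -/
theorem exists_abs_sum_sum_kernelWeight_mul_cov_sub_le (hf : BoundedDensity f c N)
    (hi : ScaledC2 (Set.Icc 0 1) Mi 1 (fun s => (f s)⁻¹) i1 i2) (hMi : 0 ≤ Mi)
    (hk : IsSmoothKernel Mk k k1 k2) (heven : ∀ u, k (-u) = k u) (hint_eq : ∫ z in (-1)..1, k z = 1)
    (hR : IsPiecewiseSmoothCov R R10 R01 R20 R11 R02 Rm Rp A) (hx : x ∈ Set.Ioo (0 : ℝ) 1) :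
    ∃ C, 0 ≤ C ∧ ∀ (n : ℕ) (h : ℝ) (τ : ℕ → ℝ), IsQuantileGrid f n τ → Admissible n x h →
      |∑ i ∈ Finset.range (n + 1), ∑ j ∈ Finset.range (n + 1),
          kernelWeight f k n τ x h i * kernelWeight f k n τ x h j * R (τ i) (τ j)
        - (R x x - (Rm x - Rp x) / 2 * (h * (∫ u in (-1)..1, ∫ v in (-1)..1, |u - v| * k u * k v)
          - 1 / (6 * n ^ 2 * h) * ((∫ u in (-1)..1, k u ^ 2) * (f x)⁻¹ ^ 2)))|
        ≤ C * (h ^ 2 + (1 / (n * h)) ^ 3) := by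
  obtain ⟨CD, hCD, hD⟩ := exists_abs_sum_sum_kernelWeight_mul_abs_sub_le hf hi hMi hk hint_eq x
  have hMk := hk.nonneg
  have hA := hR.const_nonneg
  have hN := hf.nonneg
  have hc := hf.pos
  have hT := trapConst_nonneg hf hMi
  have hone : ScaledC2 (Set.Icc 0 1) 1 1 (fun _ => 1) (fun _ => 0) (fun _ => 0) :=
    ⟨fun s _ => hasDerivWithinAt_const _ _ _, fun s _ => hasDerivWithinAt_const _ _ _,
      by simp, by simp, by simp, by simp⟩
  have hlin : ScaledC2 (Set.Icc 0 1) 1 1 (fun s => s - x) (fun _ => 1) (fun _ => 0) := by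
    refine ⟨fun s _ => ((hasDerivAt_id s).sub_const x).hasDerivWithinAt,
      fun s _ => hasDerivWithinAt_const _ _ _, fun s hs => ?_, by simp, by simp, by simp⟩
    rw [abs_le]
    constructor <;> linarith [hs.1, hs.2, hx.1, hx.2]
  set T := trapConst c N Mi
  set C0 := (2 * N + 2) * (Mk * c⁻¹)
  have hC0 : 0 ≤ C0 := by positivity
  set κ := (Rm x + Rp x) / 2
  set β := (Rm x - Rp x) / 2
  refine ⟨C0 * C0 * (8 * A) + |R x x| * ((C0 + 1) * (T * Mk)) + 2 * |κ| * (C0 * (T * Mk))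
    + |β| * CD, by positivity, fun n h τ hτ ha => ?_⟩
  have hh := ha.pos
  have hb := sum_abs_kernelWeight_le hf hτ ha hk
  have hS0 := abs_sum_kernelWeight_mul_sub_le hf hi hMi hτ ha hk hone zero_le_one
  have hS1 := abs_sum_kernelWeight_mul_sub_le hf hi hMi hτ ha hk hlin zero_le_one
  have hD := hD n h τ hτ ha
  have e1 : ∫ z in (-1)..1, k z * (x - h * z - x) = 0 := by
    have : ∀ z, k z * (x - h * z - x) = -h * (k z * z) := fun z => by ring
    simp only [this]
    rw [intervalIntegral.integral_const_mul, integral_mul_id_eq_zero_of_even heven, mul_zero]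
  rw [e1, sub_zero, mul_one] at hS1
  simp only [mul_one] at hS0
  rw [hint_eq] at hS0
  set η := (1 / ((n : ℝ) * h)) ^ 3
  have hη : 0 ≤ η := by positivity
  set b := kernelWeight f k n τ x h
  set D0 := h * (∫ u in (-1)..1, ∫ v in (-1)..1, |u - v| * k u * k v)
          - 1 / (6 * n ^ 2 * h) * ((∫ u in (-1)..1, k u ^ 2) * (f x)⁻¹ ^ 2)
  have hexp : |∑ i ∈ Finset.range (n + 1), ∑ j ∈ Finset.range (n + 1), (b i * b j * R (τ i) (τ j)
      - b i * b j * (R x x + κ * ((τ i - x) + (τ j - x)) - β * |τ i - τ j|))|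
      ≤ C0 * C0 * (8 * A * h ^ 2) := by
    refine abs_sum_sum_le_of_abs_le_mul (p := b) (q := b) (fun i _ j _ => ?_) (by positivity) hb hb
    rw [← mul_sub, abs_mul, abs_mul]
    rcases le_or_gt h |x - τ i| with h1 | h1
    · rw [show b i = 0 from hk.kernelWeight_eq_zero hh h1]
      simp
    rcases le_or_gt h |x - τ j| with h2 | h2
    · rw [show b j = 0 from hk.kernelWeight_eq_zero hh h2]
      simp
    rw [abs_lt] at h1 h2
    refine mul_le_mul_of_nonneg_left (hR.abs_expansion_le hx hh ha.window ?_ ?_) (by positivity)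
    · exact ⟨by linarith [h1.2], by linarith [h1.1]⟩
    · exact ⟨by linarith [h2.2], by linarith [h2.1]⟩
  set S0 := ∑ i ∈ Finset.range (n + 1), b i
  set S1 := ∑ i ∈ Finset.range (n + 1), b i * (τ i - x)
  set D := ∑ i ∈ Finset.range (n + 1), ∑ j ∈ Finset.range (n + 1), b i * b j * |τ i - τ j|
  have hsplit : ∑ i ∈ Finset.range (n + 1), ∑ j ∈ Finset.range (n + 1),
      b i * b j * (R x x + κ * ((τ i - x) + (τ j - x)) - β * |τ i - τ j|)
      = R x x * (S0 * S0) + κ * (S1 * S0 + S0 * S1) - β * D := by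
    simp only [S0, S1, D, Finset.sum_mul_sum]
    simp only [Finset.mul_sum, ← Finset.sum_add_distrib, ← Finset.sum_sub_distrib]
    refine Finset.sum_congr rfl fun i _ => Finset.sum_congr rfl fun j _ => ?_
    ring
  simp only [Finset.sum_sub_distrib] at hexp
  rw [hsplit] at hexp
  have hS0abs : |S0| ≤ C0 := (Finset.abs_sum_le_sum_abs _ _).trans hb
  have q0 : |R x x * ((S0 + 1) * (S0 - 1))| ≤ |R x x| * ((C0 + 1) * (T * Mk * η)) := by
    rw [abs_mul, abs_mul]
    have : |S0 + 1| ≤ C0 + 1 := (abs_add_le _ _).trans (by simpa using hS0abs)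
    gcongr
  have q1 : |2 * κ * (S0 * S1)| ≤ 2 * |κ| * (C0 * (T * Mk * η)) := by
    rw [abs_mul, abs_mul, abs_mul, abs_two]
    gcongr
  have q2 : |β * (D - D0)| ≤ |β| * (CD * (h ^ 2 + η)) := by
    rw [abs_mul]
    gcongr
  set Q := ∑ i ∈ Finset.range (n + 1), ∑ j ∈ Finset.range (n + 1), b i * b j * R (τ i) (τ j)
  have e : Q - (R x x - β * D0) = (Q - (R x x * (S0 * S0) + κ * (S1 * S0 + S0 * S1) - β * D))
      + R x x * ((S0 + 1) * (S0 - 1)) + 2 * κ * (S0 * S1) - β * (D - D0) := by ring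
  rw [e]
  refine (abs_sub _ _).trans ((add_le_add ((abs_add_le _ _).trans
    (add_le_add ((abs_add_le _ _).trans (add_le_add hexp q0)) q1)) q2).trans ?_)
  have a1 : 0 ≤ C0 * C0 * (8 * A) * η := by positivity
  have a2 : 0 ≤ (|R x x| * ((C0 + 1) * (T * Mk)) + 2 * |κ| * (C0 * (T * Mk))) * h ^ 2 := by
    positivity
  linarith

/-- Expansion of the variance of the trapezoidal estimator. -/
theorem exists_abs_Qform_sub_le (hf : BoundedDensity f c N)
    (hi : ScaledC2 (Set.Icc 0 1) Mi 1 (fun s => (f s)⁻¹) i1 i2) (hMi : 0 ≤ Mi)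
    (hk : IsSmoothKernel Mk k k1 k2) (heven : ∀ u, k (-u) = k u) (hint_eq : ∫ z in (-1)..1, k z = 1)
    (hR : IsPiecewiseSmoothCov R R10 R01 R20 R11 R02 Rm Rp A) (hx : x ∈ Set.Ioo (0 : ℝ) 1) :
    ∃ C, 0 ≤ C ∧ ∀ (n : ℕ) (h : ℝ), IsQuantileGrid f n (designGrid t n) → Admissible n x h →
      |Qform k f R t n x h
        - (R x x - (Rm x - Rp x) / 2 * (h * (∫ u in (-1)..1, ∫ v in (-1)..1, |u - v| * k u * k v)
          - 1 / (6 * n ^ 2 * h) * ((∫ u in (-1)..1, k u ^ 2) * (f x)⁻¹ ^ 2)))|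
        ≤ C * (h ^ 2 + (1 / (n * h)) ^ 3) := by
  obtain ⟨CW, hCW, hW⟩ :=
    exists_abs_sum_sum_kernelWeight_mul_cov_sub_le hf hi hMi hk heven hint_eq hR hx
  obtain ⟨B, hB⟩ := (isCompact_Icc.prod isCompact_Icc).exists_bound_of_continuousOn hR.cont
  have hB0 : 0 ≤ B := (norm_nonneg _).trans (hB (0, 0) (by simp))
  have hMk := hk.nonneg
  have hN := hf.nonneg
  have hc := hf.pos
  set C0 := (2 * N + 2) * (Mk * c⁻¹)
  set C1 := (2 * N + 2) * (Mk * c⁻¹ ^ 4)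
  have hC0 : 0 ≤ C0 := by positivity
  have hC1 : 0 ≤ C1 := by positivity
  refine ⟨2 * C1 * C0 * B + CW, by positivity, fun n h hτ ha => ?_⟩
  have hh := ha.pos
  have hb := sum_abs_kernelWeight_le hf hτ ha hk
  have hab := sum_abs_trapWeight_sub_kernelWeight_le hf hτ ha hk
  have hW := hW n h (designGrid t n) hτ ha
  rw [Qform_eq_sum_trapWeight]
  set τ := designGrid t n
  set b := kernelWeight f k n τ x h
  set a := trapWeight k f t n x h
  set η := (1 / ((n : ℝ) * h)) ^ 3
  have hη : 0 ≤ η := by positivity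
  have haC : ∑ j ∈ Finset.range (n + 1), |a j| ≤ C0 := by
    refine (Finset.sum_le_sum fun j _ => ?_).trans hb
    have hcoef := trapCoef_mem_Icc (trapIdx t n x h) j
    change |trapCoef (trapIdx t n x h) j * b j| ≤ |b j|
    rw [abs_mul, abs_of_nonneg hcoef.1]
    exact mul_le_of_le_one_left (abs_nonneg _) hcoef.2
  have hRb : ∀ i ∈ Finset.range (n + 1), ∀ j ∈ Finset.range (n + 1), |R (τ i) (τ j)| ≤ B :=
    fun i hi j hj => hB (τ i, τ j) ⟨hτ.mem i (Nat.lt_succ_iff.1 (Finset.mem_range.1 hi)),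
      hτ.mem j (Nat.lt_succ_iff.1 (Finset.mem_range.1 hj))⟩
  have d1 := abs_sum_sum_le_of_abs_le_mul (s := Finset.range (n + 1))
    (F := fun i j => (a i - b i) * a j * R (τ i) (τ j)) (p := fun i => a i - b i) (q := a)
    (fun i hi j hj => by
      rw [abs_mul, abs_mul]
      exact mul_le_mul_of_nonneg_left (hRb i hi j hj) (by positivity)) hB0 hab haC
  have d2 := abs_sum_sum_le_of_abs_le_mul (s := Finset.range (n + 1))
    (F := fun i j => b i * (a j - b j) * R (τ i) (τ j)) (p := b) (q := fun i => a i - b i)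
    (fun i hi j hj => by
      rw [abs_mul, abs_mul]
      exact mul_le_mul_of_nonneg_left (hRb i hi j hj) (by positivity)) hB0 hb hab
  have e : ∑ i ∈ Finset.range (n + 1), ∑ j ∈ Finset.range (n + 1), a i * a j * R (τ i) (τ j)
      = (∑ i ∈ Finset.range (n + 1), ∑ j ∈ Finset.range (n + 1),
          (a i - b i) * a j * R (τ i) (τ j))
        + (∑ i ∈ Finset.range (n + 1), ∑ j ∈ Finset.range (n + 1),
          b i * (a j - b j) * R (τ i) (τ j))
        + ∑ i ∈ Finset.range (n + 1), ∑ j ∈ Finset.range (n + 1), b i * b j * R (τ i) (τ j) := by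
    simp only [← Finset.sum_add_distrib]
    refine Finset.sum_congr rfl fun i _ => Finset.sum_congr rfl fun j _ => ?_
    ring
  rw [e, add_sub_assoc]
  refine (abs_add_le _ _).trans
    ((add_le_add ((abs_add_le _ _).trans (add_le_add d1 d2)) hW).trans ?_)
  have : 0 ≤ 2 * C1 * C0 * B * h ^ 2 := by positivity
  linarith

end

/-- Combination of the expansions of the bias and of the variance. -/
lemma abs_sq_add_div_sub_le {b b0 q q0 Cb Cq h : ℝ} {n m : ℕ} (hh : 0 < h) (h1 : h ≤ 1)
    (hn : 1 ≤ n) (hm : 1 ≤ m) (hb : |b - h ^ 2 * b0| ≤ Cb * (h ^ 3 + (1 / (n * h)) ^ 3))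
    (hq : |q - q0| ≤ Cq * (h ^ 2 + (1 / (n * h)) ^ 3)) :
    |(b ^ 2 + q / m) - (q0 / m + h ^ 4 * b0 ^ 2)|
      ≤ ((2 * |b0| * Cb + 2 * Cb ^ 2) * h) * h ^ 4 + (Cq * h) * (h / m)
        + (2 * |b0| * Cb) * (1 / ((n : ℝ) ^ 3 * h)) + Cq * (1 / ((m : ℝ) * n ^ 3 * h ^ 3))
        + 2 * Cb ^ 2 * (1 / ((n : ℝ) ^ 6 * h ^ 6)) := by
  have hn' : (0 : ℝ) < n := by exact_mod_cast hn
  have hm' : (0 : ℝ) < m := by exact_mod_cast hm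
  set η := 1 / ((n : ℝ) * h) with hη
  have e1 : 1 / ((n : ℝ) ^ 3 * h) = h ^ 2 * η ^ 3 := by rw [hη]; field_simp
  have e2 : 1 / ((m : ℝ) * n ^ 3 * h ^ 3) = η ^ 3 / m := by rw [hη]; field_simp
  have e3 : 1 / ((n : ℝ) ^ 6 * h ^ 6) = (η ^ 3) ^ 2 := by rw [hη]; field_simp
  have hη3 : 0 ≤ η ^ 3 := by positivity
  rw [e1, e2, e3]
  set w := η ^ 3
  set d := b - h ^ 2 * b0
  have e : (b ^ 2 + q / m) - (q0 / m + h ^ 4 * b0 ^ 2)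
      = 2 * h ^ 2 * (b0 * d) + d ^ 2 + (q - q0) / m := by
    simp only [d]
    ring
  have p1 : |2 * h ^ 2 * (b0 * d)| ≤ 2 * h ^ 2 * (|b0| * (Cb * (h ^ 3 + w))) := by
    rw [abs_mul, abs_mul b0, abs_of_nonneg (by positivity : 0 ≤ 2 * h ^ 2)]
    gcongr
  have p2 : |d ^ 2| ≤ Cb ^ 2 * (2 * (h ^ 5 + w ^ 2)) := by
    rw [abs_pow]
    have h6 : h ^ 6 ≤ h ^ 5 := pow_le_pow_of_le_one hh.le h1 (by norm_num)
    calc |d| ^ 2 ≤ (Cb * (h ^ 3 + w)) ^ 2 := by gcongr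
      _ = Cb ^ 2 * (h ^ 3 + w) ^ 2 := by ring
      _ ≤ Cb ^ 2 * (2 * (h ^ 5 + w ^ 2)) := by
        gcongr
        nlinarith [sq_nonneg (h ^ 3 - w)]
  have p3 : |(q - q0) / m| ≤ Cq * (h ^ 2 + w) / m := by
    rw [abs_div, abs_of_pos hm']
    gcongr
  rw [e]
  refine (abs_add_le _ _).trans ((add_le_add ((abs_add_le _ _).trans (add_le_add p1 p2)) p3).trans
    (le_of_eq ?_))
  field_simp
  ring

lemma exists_scaledC2_of_contDiffOn {g : ℝ → ℝ} (hg : ContDiffOn ℝ 2 g (Set.Icc 0 1))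
    (hlip : ∃ L : NNReal,
      LipschitzOnWith L (iteratedDerivWithin 2 g (Set.Icc 0 1)) (Set.Icc 0 1)) :
    ∃ M, 0 ≤ M ∧ ScaledC2 (Set.Icc 0 1) M 1 g (derivWithin g (Set.Icc 0 1))
      (iteratedDerivWithin 2 g (Set.Icc 0 1)) := by
  obtain ⟨L, hL⟩ := hlip
  have hu : UniqueDiffOn ℝ (Set.Icc (0 : ℝ) 1) := uniqueDiffOn_Icc zero_lt_one
  have hd1 := hg.differentiableOn_iteratedDerivWithin (m := 1) (by norm_num) hu
  refine ScaledC2.exists_of_lipschitz (L := L)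
    (fun s hs => (hg.differentiableOn (by norm_num) s hs).hasDerivWithinAt) (fun s hs => ?_)
    fun s hs u hu => by simpa [Real.dist_eq] using hL.dist_le_mul s hs u hu
  have e : Set.EqOn (derivWithin g (Set.Icc 0 1)) (iteratedDerivWithin 1 g (Set.Icc 0 1))
      (Set.Icc 0 1) := fun r _ => by rw [iteratedDerivWithin_one]
  rw [iteratedDerivWithin_succ]
  exact (hd1 s hs).hasDerivWithinAt.congr e (e hs)

theorem trapezoidal_estimator_MSE
    (f : ℝ → ℝ) (cf : ℝ) (hcf : 0 < cf)
    (hf_lb : ∀ s ∈ Set.Icc (0:ℝ) 1, cf ≤ f s)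
    (hf_smooth : ContDiffOn ℝ 2 f (Set.Icc 0 1))
    (hf''_lip : ∃ L : NNReal,
      LipschitzOnWith L (iteratedDerivWithin 2 f (Set.Icc 0 1)) (Set.Icc 0 1))
    (hf_density : ∫ s in (0:ℝ)..1, f s = 1)
    (t : ℕ → ℕ → ℝ)
    (ht_mem : ∀ n i : ℕ, 1 ≤ i → i ≤ n → t n i ∈ Set.Icc (0:ℝ) 1)
    (ht_def : ∀ n i : ℕ, 1 ≤ i → i ≤ n →
      ∫ s in (0:ℝ)..(t n i), f s = (i : ℝ) / n)
    (ht_mono : ∀ n : ℕ, StrictMonoOn (t n) (Set.Icc 1 n))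
    (K : ℝ → ℝ)
    (hK_even : ∀ u : ℝ, K (-u) = K u)
    (hK_supp : ∀ u : ℝ, u ∉ Set.Icc (-1:ℝ) 1 → K u = 0)
    (hK_smooth : ContDiff ℝ 2 K)
    (hK''_lip : ∃ L : NNReal,
      LipschitzOnWith L (iteratedDeriv 2 K) (Set.Icc (-1:ℝ) 1))
    (hK_int : ∫ u in (-1:ℝ)..1, K u = 1)
    (g : ℝ → ℝ)
    (hg_smooth : ContDiffOn ℝ 2 g (Set.Icc 0 1))
    (hg''_lip : ∃ L : NNReal,
      LipschitzOnWith L (iteratedDerivWithin 2 g (Set.Icc 0 1)) (Set.Icc 0 1))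
    (R : ℝ → ℝ → ℝ)
    (hR_cont : ContinuousOn (fun p : ℝ × ℝ => R p.1 p.2)
      (Set.Icc 0 1 ×ˢ Set.Icc 0 1))
    (hR_symm : ∀ s u : ℝ, R s u = R u s)
    (Rm Rp : ℝ → ℝ)
    (hRm : ∀ u ∈ Set.Icc (0:ℝ) 1,
      HasDerivWithinAt (fun s => R u s) (Rm u) (Set.Iio u) u)
    (hRp : ∀ u ∈ Set.Icc (0:ℝ) 1,
      HasDerivWithinAt (fun s => R u s) (Rp u) (Set.Ioi u) u)
    (α : ℝ → ℝ) (hα : ∀ u : ℝ, α u = Rm u - Rp u)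
    (hα_cont : ContinuousOn α (Set.Icc 0 1))
    (R10 R01 R20 R11 R02 : ℝ → ℝ → ℝ)
    (hR10 : ∀ u v : ℝ, u ≠ v → HasDerivAt (fun s => R s v) (R10 u v) u)
    (hR01 : ∀ u v : ℝ, u ≠ v → HasDerivAt (fun s => R u s) (R01 u v) v)
    (hR20 : ∀ u v : ℝ, u ≠ v → HasDerivAt (fun s => R10 s v) (R20 u v) u)
    (hR11 : ∀ u v : ℝ, u ≠ v → HasDerivAt (fun s => R10 u s) (R11 u v) v)
    (hR02 : ∀ u v : ℝ, u ≠ v → HasDerivAt (fun s => R01 u s) (R02 u v) v)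
    (hRij_cont : ∀ Rij ∈ ([R10, R01, R20, R11, R02] : List (ℝ → ℝ → ℝ)),
      ContinuousOn (fun p : ℝ × ℝ => Rij p.1 p.2) {p : ℝ × ℝ | p.1 ≠ p.2})
    (A : ℝ)
    (hA : ∀ Rij ∈ ([R10, R01, R20, R11, R02] : List (ℝ → ℝ → ℝ)),
      ∀ u ∈ Set.Icc (0:ℝ) 1, ∀ v ∈ Set.Icc (0:ℝ) 1, u ≠ v → |Rij u v| ≤ A)
    (hR02_lip : ∀ u ∈ Set.Icc (0:ℝ) 1, ∃ L : NNReal,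
      LipschitzOnWith L (fun v => R02 u v) (Set.Icc (0:ℝ) 1))
    (x : ℝ) (hx : x ∈ Set.Ioo (0:ℝ) 1) :
    ∃ (C : ℝ) (ρ : ℝ → ℝ), 0 < C ∧ (∀ s, 0 ≤ ρ s) ∧
      Tendsto ρ (𝓝[>] (0:ℝ)) (𝓝 0) ∧
      ∀ (n m : ℕ) (h : ℝ), 1 ≤ n → 1 ≤ m → 0 < h → h < 1 → 1 ≤ (n : ℝ) * h →
        Set.Icc (x - h) (x + h) ⊆ Set.Icc (0:ℝ) 1 →
        (trapIdx t n x h).Nonempty →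
        |((trapSum t n x h (fun s => phiK K x h s * g s / f s) - g x) ^ 2
            + Qform K f R t n x h / (m : ℝ))
          - (1 / (m : ℝ)) * (R x x - (h / 2) * α x
              * (∫ u in (-1:ℝ)..1, ∫ v in (-1:ℝ)..1, |u - v| * K u * K v))
          - ((∫ u in (-1:ℝ)..1, (K u) ^ 2)
              / (12 * (m : ℝ) * (n : ℝ) ^ 2 * h)) * (α x / (f x) ^ 2)
          - (1 / 4) * h ^ 4 * (iteratedDerivWithin 2 g (Set.Icc 0 1) x) ^ 2
              * (∫ u in (-1:ℝ)..1, u ^ 2 * K u) ^ 2|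
          ≤ ρ h * (h ^ 4 + h / (m : ℝ))
            + C * (1 / ((n : ℝ) ^ 3 * h) + 1 / ((m : ℝ) * (n : ℝ) ^ 3 * h ^ 3)
                + 1 / ((m : ℝ) * (n : ℝ) ^ 2) + 1 / ((n : ℝ) ^ 6 * h ^ 6)) := by
  obtain ⟨Mk, hk⟩ := exists_isSmoothKernel_of_contDiff hK_supp hK_smooth hK''_lip
  obtain ⟨Mf, hMf, hf⟩ := exists_scaledC2_of_contDiffOn hf_smooth hf''_lip
  obtain ⟨Mg, hMg, hg⟩ := exists_scaledC2_of_contDiffOn hg_smooth hg''_lip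
  obtain ⟨Mi, i1, i2, hMi, hi⟩ := ScaledC2.exists_inv hf hcf hf_lb
  have hfd : BoundedDensity f cf Mf :=
    ⟨hcf, hf_smooth.continuousOn, hf_lb, fun s hs => (le_abs_self _).trans (hf.bound s hs)⟩
  have hR : IsPiecewiseSmoothCov R R10 R01 R20 R11 R02 Rm Rp A :=
    ⟨hR_cont, hR_symm, hRm, hRp, hR10, hR01, hR20, hR11, hR02, hA R20 (by simp),
      hA R11 (by simp), hA R02 (by simp)⟩
  obtain ⟨Cb, hCb, hbias⟩ := exists_abs_trapSum_sub_le (t := t) hfd hi hMi hk hK_even hK_int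
    hg hMg x
  obtain ⟨Cq, hCq, hvar⟩ := exists_abs_Qform_sub_le (t := t) hfd hi hMi hk hK_even hK_int hR hx
  set B := ∫ u in (-1:ℝ)..1, u ^ 2 * K u
  set g2 := iteratedDerivWithin 2 g (Set.Icc 0 1) x
  set b0 := 1 / 2 * g2 * B
  set C := 2 * |b0| * Cb + 2 * Cb ^ 2 + Cq + 1
  have hC : 0 < C := by positivity
  refine ⟨C, fun s => C * |s|, hC, fun s => by positivity, ?_, ?_⟩
  · have : Tendsto (fun s : ℝ => C * |s|) (𝓝 0) (𝓝 (C * |0|)) :=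
      Continuous.tendsto (by fun_prop) 0
    rw [abs_zero, mul_zero] at this
    exact this.mono_left nhdsWithin_le_nhds
  intro n m h hn hm hh h1 hnh hW _
  have ha : Admissible n x h := ⟨hh, h1.le, hnh, hW⟩
  have hτ := isQuantileGrid_designGrid hfd hf_density ht_mem ht_def hn
  have hb := hbias n h hτ ha
  have hq := hvar n h hτ ha
  rw [← hα x] at hq
  have hn' : (0 : ℝ) < n := by exact_mod_cast hn
  have hm' : (0 : ℝ) < m := by exact_mod_cast hm
  have hfx : f x ≠ 0 := (hcf.trans_le (hf_lb x ⟨hx.1.le, hx.2.le⟩)).ne'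
  set bias := trapSum t n x h (fun s => phiK K x h s * g s / f s) - g x
  have hb' : |bias - h ^ 2 * b0| ≤ Cb * (h ^ 3 + (1 / (n * h)) ^ 3) := by
    convert hb using 2
    simp only [bias, b0]
    ring
  have key := abs_sq_add_div_sub_le hh h1.le hn hm hb' hq
  set CK := ∫ u in (-1:ℝ)..1, ∫ v in (-1:ℝ)..1, |u - v| * K u * K v
  set V := ∫ u in (-1:ℝ)..1, (K u) ^ 2
  have e : bias ^ 2 + Qform K f R t n x h / m - 1 / m * (R x x - h / 2 * α x * CK)
        - V / (12 * m * n ^ 2 * h) * (α x / f x ^ 2) - 1 / 4 * h ^ 4 * g2 ^ 2 * B ^ 2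
      = (bias ^ 2 + Qform K f R t n x h / m)
        - ((R x x - α x / 2 * (h * CK - 1 / (6 * n ^ 2 * h) * (V * (f x)⁻¹ ^ 2))) / m
          + h ^ 4 * b0 ^ 2) := by
    simp only [b0]
    field_simp
    ring
  rw [e]
  refine key.trans ?_
  simp only [abs_of_pos hh]
  set X1 := 1 / ((n : ℝ) ^ 3 * h)
  set X2 := 1 / ((m : ℝ) * n ^ 3 * h ^ 3)
  set X3 := 1 / ((m : ℝ) * n ^ 2)
  set X4 := 1 / ((n : ℝ) ^ 6 * h ^ 6)
  have w1 : 2 * |b0| * Cb + 2 * Cb ^ 2 ≤ C := by simp only [C]; linarith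
  have w2 : 2 * |b0| * Cb ≤ C := le_trans (by linarith [sq_nonneg Cb]) w1
  have w3 : 2 * Cb ^ 2 ≤ C := le_trans (le_add_of_nonneg_left (by positivity)) w1
  have w4 : Cq ≤ C := by
    have : 0 ≤ 2 * |b0| * Cb + 2 * Cb ^ 2 := by positivity
    simp only [C]
    linarith
  calc _ ≤ C * h * h ^ 4 + C * h * (h / m) + C * X1 + C * X2 + C * X4 := by gcongr
    _ ≤ C * h * h ^ 4 + C * h * (h / m) + C * X1 + C * X2 + C * X4 + C * X3 :=
      le_add_of_nonneg_right (by positivity)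
    _ = C * h * (h ^ 4 + h / m) + C * (X1 + X2 + X3 + X4) := by ring
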